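/- For every integer n ≥ 0, ζ⋆(2, {1,3}^n, 1, 2) = ( 4 + 1/(2·(−4)^n) )·ζ(4n+5) − (8/(3ζ(2))) · ∑_{a+b+2c = 2n+2, a,b,c ≥ 0} (−1)^{a+c}(1 − 2^{2a})·4^{−(a+b+c)}·ζ(2a)ζ(2b)ζ(4c+3). -/

import Mathlib

/-- The monotone index sequence `n_0 ≤ n_1 ≤ ⋯` of positive integers parametrized by the
gap function `g`: `n i = 1 + g 0 + g 1 + ⋯ + g i`.  Every weakly increasing tuple
`1 ≤ n_0 ≤ ⋯ ≤ n_{d−1}` arises from exactly one `g : Fin d → ℕ`. -/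
def idxSeq {d : ℕ} (g : Fin d → ℕ) (i : Fin d) : ℕ :=
  1 + ∑ j ∈ Finset.univ.filter (· ≤ i), g j

/-- The multiple zeta star value
`ζ⋆(s₁,…,s_d) = ∑_{1 ≤ n₁ ≤ n₂ ≤ ⋯ ≤ n_d} 1/(n₁^{s₁} ⋯ n_d^{s_d})`. -/
noncomputable def zetaStar {d : ℕ} (s : Fin d → ℕ) : ℝ :=
  ∑' g : Fin d → ℕ, ∏ i, 1 / (idxSeq g i : ℝ) ^ s i

/-- The repeating string `{1,3}^n`: entries alternate `1, 3, 1, 3, …` (length `2n`). -/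
def pat13 (n : ℕ) : Fin (2 * n) → ℕ := fun i => if (i : ℕ) % 2 = 0 then 1 else 3

open Filter Topology

/-- Product `E_m(σ)`. -/
noncomputable def EE (d σ : ℝ) : ℕ → ℝ
  | 0 => 1
  | m + 1 => EE d σ m * (((2 * (m:ℝ) + 2) ^ 2 + d) * ((2 * (m:ℝ) + 1) ^ 2 - σ ^ 2) /
      (((2 * (m:ℝ) + 2) ^ 2 - σ ^ 2) * ((2 * (m:ℝ) + 1) ^ 2 + d)))

noncomputable def uu (d σ : ℝ) (m : ℕ) : ℝ :=
  EE d σ m / ((2 * (m:ℝ) + 1) * ((2 * (m:ℝ) + 1) ^ 2 + d)) +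
  EE d σ (m + 1) / ((2 * (m:ℝ) + 2) * ((2 * (m:ℝ) + 2) ^ 2 + d))

def NotEven (σ : ℝ) : Prop := ∀ k : ℤ, σ ≠ 2 * k

lemma NotEven.add_two {σ : ℝ} (h : NotEven σ) : NotEven (σ + 2) := by
  intro k hk
  apply h (k - 1)
  push_cast
  linarith

lemma NotEven.neg {σ : ℝ} (h : NotEven σ) : NotEven (-σ) := by
  intro k hk
  apply h (-k)
  push_cast
  linarith

lemma NotEven.ne_sub {σ : ℝ} (h : NotEven σ) (k : ℤ) : 2 * (k : ℝ) - σ ≠ 0 := by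
  intro hk
  exact h k (by linarith)

lemma NotEven.ne_add {σ : ℝ} (h : NotEven σ) (k : ℤ) : 2 * (k : ℝ) + σ ≠ 0 := by
  intro hk
  apply h (-k)
  push_cast; linarith

lemma NotEven.facts {σ : ℝ} (h : NotEven σ) (hs : -1 < σ) (m : ℕ) :
    2 * (m:ℝ) - σ ≠ 0 ∧ 2 * (m:ℝ) + 2 - σ ≠ 0 ∧ 2 * (m:ℝ) + 1 + σ ≠ 0 ∧ 2 * (m:ℝ) + 3 + σ ≠ 0
    ∧ 2 * (m:ℝ) + 2 + σ ≠ 0 ∧ 2 * (m:ℝ) + 4 + σ ≠ 0 ∧ σ + 2 ≠ 0 ∧ σ ≠ 0 := by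
  have hm : (0:ℝ) ≤ m := Nat.cast_nonneg m
  refine ⟨?_, ?_, ?_, ?_, ?_, ?_, ?_, ?_⟩
  · exact_mod_cast h.ne_sub m
  · have := h.ne_sub (m+1); push_cast at this; intro h'; apply this; linarith
  · linarith
  · linarith
  · linarith
  · linarith
  · linarith
  · have := h 0; simpa using this

lemma EE_shift (d σ : ℝ) (hd : 0 < d) (h : NotEven σ) (hs : -1 < σ) (m : ℕ) :
    EE d σ m = EE d (σ + 2) m * (σ * (2 * m + 2 + σ) * (2 * m - 1 - σ) /
      ((2 * m - σ) * (σ + 2) * (2 * m + 1 + σ))) := by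
  induction m with
  | zero =>
    obtain ⟨h1, h2, h3, h4, h5, h6, h7, h8⟩ := h.facts hs 0
    simp only [EE]
    push_cast at *
    field_simp
    ring_nf at *
  | succ m ih =>
    obtain ⟨h1, h2, h3, h4, h5, h6, h7, h8⟩ := h.facts hs m
    simp only [EE]
    rw [ih]
    have e1 : (2 * (m:ℝ) + 2) ^ 2 - σ ^ 2 = (2 * (m:ℝ) + 2 - σ) * (2 * (m:ℝ) + 2 + σ) := by ring
    have e2 : (2 * (m:ℝ) + 2) ^ 2 - (σ + 2) ^ 2 = (2 * (m:ℝ) - σ) * (2 * (m:ℝ) + 4 + σ) := by ring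
    have e3 : 2 * (((m+1:ℕ) : ℝ)) - σ = 2 * (m:ℝ) + 2 - σ := by push_cast; ring
    have e4 : 2 * (((m+1:ℕ) : ℝ)) + 1 + σ = 2 * (m:ℝ) + 3 + σ := by push_cast; ring
    have e5 : (2 * (m:ℝ) + 1) ^ 2 + d ≠ 0 := by positivity
    rw [e1, e2, e3, e4]
    push_cast
    generalize EE d (σ + 2) m = E
    rw [mul_assoc E, mul_assoc E, div_mul_div_comm, div_mul_div_comm]
    congr 1
    rw [div_eq_div_iff (by simp [*]) (by simp [*])]
    ring

/-- WZ certificate. -/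
noncomputable def ZZ (d s : ℝ) (m : ℕ) : ℝ :=
  EE d (s + 2) m *
   (((8+20*s+18*s^2+8*s^3+2*s^4+d*(2+4*s+2*s^2)) + (2*(m:ℝ))*(4+16*s+16*s^2+8*s^3+2*s^4+d*(4*s+2*s^2))
     + (2*(m:ℝ))^2*(-8-8*s-4*s^2-4*d) + (2*(m:ℝ))^3*(-4-4*s-2*s^2-2*d)) /
    ((s+2)*(s^2+d)*((s+2)^2+d)*((2*m-s)*(2*m+1+s)*(2*m+1))))

lemma WZ_step (d σ : ℝ) (hd : 0 < d) (h : NotEven σ) (hs : -1 < σ) (m : ℕ) :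
    uu d (σ + 2) m - uu d σ m = ZZ d σ (m + 1) - ZZ d σ m := by
  obtain ⟨h1, h2, h3, h4, h5, h6, h7, h8⟩ := h.facts hs m
  unfold uu ZZ
  rw [EE_shift d σ hd h hs (m+1), EE_shift d σ hd h hs m]
  simp only [EE]
  generalize EE d (σ + 2) m = E
  have e2 : (2 * (m:ℝ) + 2) ^ 2 - (σ + 2) ^ 2 = (2 * (m:ℝ) - σ) * (2 * (m:ℝ) + 4 + σ) := by ring
  have e3 : 2 * (((m+1:ℕ) : ℝ)) - σ = 2 * (m:ℝ) + 2 - σ := by push_cast; ring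
  have e4 : 2 * (((m+1:ℕ) : ℝ)) + 1 + σ = 2 * (m:ℝ) + 3 + σ := by push_cast; ring
  have e6 : 2 * (((m+1:ℕ) : ℝ)) + 1 = 2 * (m:ℝ) + 3 := by push_cast; ring
  have e5 : (2 * (m:ℝ) + 1) ^ 2 + d ≠ 0 := by positivity
  have e7 : (2 * (m:ℝ) + 2) ^ 2 + d ≠ 0 := by positivity
  have e8 : σ ^ 2 + d ≠ 0 := by positivity
  have e9 : (σ+2) ^ 2 + d ≠ 0 := by positivity
  have e10 : 2 * (m:ℝ) + 1 ≠ 0 := by positivity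
  have e11 : 2 * (m:ℝ) + 3 ≠ 0 := by positivity
  have e12 : 2 * (m:ℝ) + 2 ≠ 0 := by positivity
  rw [e2, e3, e4, e6]
  push_cast
  generalize (m:ℝ) = x at *
  have k1 : (2 * x + 1) ^ 2 - (σ + 2) ^ 2 = (2*x-1-σ)*(2*x+3+σ) := by ring
  rw [k1]
  obtain ⟨a1, ha1⟩ : ∃ a, a = 2 * x - σ := ⟨_, rfl⟩
  obtain ⟨a2, ha2⟩ : ∃ a, a = 2 * x + 2 - σ := ⟨_, rfl⟩
  obtain ⟨a3, ha3⟩ : ∃ a, a = 2 * x + 1 + σ := ⟨_, rfl⟩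
  obtain ⟨a4, ha4⟩ : ∃ a, a = 2 * x + 3 + σ := ⟨_, rfl⟩
  obtain ⟨a6, ha6⟩ : ∃ a, a = 2 * x + 4 + σ := ⟨_, rfl⟩
  obtain ⟨a7, ha7⟩ : ∃ a, a = σ + 2 := ⟨_, rfl⟩
  obtain ⟨b5, hb5⟩ : ∃ a, a = (2 * x + 1) ^ 2 + d := ⟨_, rfl⟩
  obtain ⟨b7, hb7⟩ : ∃ a, a = (2 * x + 2) ^ 2 + d := ⟨_, rfl⟩
  obtain ⟨b8, hb8⟩ : ∃ a, a = σ ^ 2 + d := ⟨_, rfl⟩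
  obtain ⟨b9, hb9⟩ : ∃ a, a = (σ + 2) ^ 2 + d := ⟨_, rfl⟩
  obtain ⟨b10, hb10⟩ : ∃ a, a = 2 * x + 1 := ⟨_, rfl⟩
  obtain ⟨b11, hb11⟩ : ∃ a, a = 2 * x + 3 := ⟨_, rfl⟩
  obtain ⟨b12, hb12⟩ : ∃ a, a = 2 * x + 2 := ⟨_, rfl⟩
  rw [← ha4, ← ha3, ← ha6, ← ha1, ← ha2, ← hb5, ← hb7, ← hb8, ← hb9, ← hb10, ← hb11, ← hb12, ← ha7] 
  rw [← ha4] at h4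
  rw [← ha3] at h3
  rw [← ha6] at h6
  rw [← ha1] at h1
  rw [← ha2] at h2
  rw [← hb5] at e5
  rw [← hb7] at e7
  rw [← hb8] at e8
  rw [← hb9] at e9
  rw [← hb10] at e10
  rw [← hb11] at e11
  rw [← hb12] at e12
  rw [← ha7] at h7
  field_simp
  subst_vars
  ring

lemma tendsto_of_inv {g : ℕ → ℝ} {f : ℝ → ℝ} {l : ℝ} (hf : ContinuousAt f 0) (h0 : f 0 = l)
    (h : ∀ m : ℕ, 1 ≤ m → g m = f ((m:ℝ)⁻¹)) : Tendsto g atTop (𝓝 l) := by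
  have h1 : Tendsto (fun m : ℕ => f ((m:ℝ)⁻¹)) atTop (𝓝 (f 0)) :=
    hf.tendsto.comp tendsto_inv_atTop_nhds_zero_nat
  rw [h0] at h1
  refine h1.congr' ?_
  filter_upwards [eventually_ge_atTop 1] with m hm
  exact (h m hm).symm

lemma EE_neg (d σ : ℝ) (m : ℕ) : EE d (-σ) m = EE d σ m := by
  induction m with
  | zero => rfl
  | succ m ih => simp only [EE, ih, neg_sq]

lemma EE_tendsto_shift {d σ θ : ℝ} (hd : 0 < d) (h : NotEven σ) (hs : -1 < σ)
    (ht : Tendsto (EE d σ) atTop (𝓝 (θ * σ))) :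
    Tendsto (EE d (σ + 2)) atTop (𝓝 (θ * (σ + 2))) := by
  have h8 : σ ≠ 0 := (h.facts hs 0).2.2.2.2.2.2.2
  have h1 : Tendsto (fun m : ℕ => ((2 * (m:ℝ) - σ) * (σ + 2) * (2 * m + 1 + σ)) / (σ * (2 * m + 2 + σ) * (2 * m - 1 - σ)))
      atTop (𝓝 ((σ + 2) / σ)) := by
    refine tendsto_of_inv (f := fun t => ((2 - σ * t) * (σ + 2) * (2 + t + σ * t)) / (σ * (2 + 2 * t + σ * t) * (2 - t - σ * t))) ?_ ?_ ?_
    · apply ContinuousAt.div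
      · fun_prop
      · fun_prop
      · simp [h8]
    · simp; field_simp
    · intro m hm
      have : (m:ℝ) ≠ 0 := by positivity
      rw [← mul_div_mul_right (c := ((m:ℝ)⁻¹)^2) _ _ (by positivity)]
      congr 1
      · field_simp
      · field_simp
  have h2 := ht.mul h1
  have e : θ * σ * ((σ + 2) / σ) = θ * (σ + 2) := by field_simp
  rw [e] at h2
  refine h2.congr' ?_
  have h3 : ∀ᶠ m : ℕ in atTop, 2 * (m:ℝ) - 1 - σ ≠ 0 := by
    filter_upwards [tendsto_natCast_atTop_atTop.eventually_gt_atTop (1 + σ), eventually_ge_atTop 1] with m hm h1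
    have : (1:ℝ) ≤ m := by exact_mod_cast h1
    have : 2 * (m:ℝ) - 1 - σ > 0 := by linarith
    exact this.ne'
  filter_upwards [h3] with m hm
  obtain ⟨h1, h2, h3, h4, h5, h6, h7, h8⟩ := h.facts hs m
  rw [EE_shift d σ hd h hs m, mul_assoc, div_mul_div_comm, mul_comm ((2 * (m:ℝ) - σ) * (σ + 2) * (2 * m + 1 + σ)), div_self, mul_one]
  simp only [ne_eq, mul_eq_zero, not_or]
  simp only [ne_eq] at *
  tauto

lemma uu_summable_of_bdd {d σ C : ℝ} (hd : 0 < d) (h : ∀ m, |EE d σ m| ≤ C) :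
    Summable (uu d σ) := by
  have hC : 0 ≤ C := (abs_nonneg _).trans (h 0)
  have h1 : Summable (fun m : ℕ => 2 * C * (1 / ((m + 1 : ℕ) : ℝ) ^ 2)) :=
    (((summable_nat_add_iff 1).2 (Real.summable_one_div_nat_pow.2 one_lt_two))).mul_left _
  refine Summable.of_norm_bounded h1 fun m => ?_
  have hm : (0:ℝ) ≤ m := Nat.cast_nonneg m
  have key : ∀ (E x : ℝ), |E| ≤ C → (m:ℝ) + 1 ≤ x → x ≥ 1 → |E / (x * (x^2 + d))| ≤ C * (1 / ((m + 1 : ℕ) : ℝ) ^ 2) := by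
    intro E x hE hx hx1
    rw [abs_div, abs_of_pos (a := x * (x^2+d)) (by positivity), mul_one_div]
    push_cast
    gcongr
    calc ((m:ℝ) + 1)^2 ≤ x ^ 2 := by gcongr
      _ ≤ x * (x^2 + d) := by nlinarith
  rw [Real.norm_eq_abs]
  unfold uu
  refine (abs_add_le _ _).trans ?_
  have a1 := key _ (2*m+1) (h m) (by linarith) (by linarith)
  have a2 := key _ (2*m+2) (h (m+1)) (by linarith) (by linarith)
  linarith

lemma uu_summable {d σ L : ℝ} (hd : 0 < d) (ht : Tendsto (EE d σ) atTop (𝓝 L)) :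
    Summable (uu d σ) := by
  obtain ⟨C, hC⟩ := (Metric.isBounded_range_of_tendsto _ ht).exists_norm_le
  exact uu_summable_of_bdd hd (C := C) fun m => hC _ ⟨m, rfl⟩

noncomputable def jj (d σ : ℝ) : ℝ := ∑' m, uu d σ m

noncomputable def phi (d θ x : ℝ) : ℝ := (1 / x - θ) / (x ^ 2 + d)

lemma ZZ_tendsto {d σ θ : ℝ} (hd : 0 < d) (h : NotEven σ) (hs : -1 < σ)
    (ht : Tendsto (EE d σ) atTop (𝓝 (θ * σ))) :
    Tendsto (ZZ d σ) atTop (𝓝 (-θ * (1 / (σ^2 + d) + 1 / ((σ+2)^2 + d)))) := by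
  have e8 : σ ^ 2 + d ≠ 0 := by positivity
  have e9 : (σ+2) ^ 2 + d ≠ 0 := by positivity
  have e7 : σ + 2 ≠ 0 := by linarith
  have h2 := EE_tendsto_shift hd h hs ht
  have e : -θ * (1 / (σ^2 + d) + 1 / ((σ+2)^2 + d)) = θ * (σ + 2) *
     ((8 * (-4-4*σ-2*σ^2-2*d)) / ((σ+2)*(σ^2+d)*((σ+2)^2+d)*8)) := by
    field_simp
    ring
  rw [e]
  refine h2.mul ?_
  refine tendsto_of_inv (f := fun t => (((8+20*σ+18*σ^2+8*σ^3+2*σ^4+d*(2+4*σ+2*σ^2))*t^3 + (2*t^2)*(4+16*σ+16*σ^2+8*σ^3+2*σ^4+d*(4*σ+2*σ^2))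
     + 4*t*(-8-8*σ-4*σ^2-4*d) + 8*(-4-4*σ-2*σ^2-2*d)) /
    ((σ+2)*(σ^2+d)*((σ+2)^2+d)*((2-σ*t)*(2+t+σ*t)*(2+t))))) ?_ ?_ ?_
  · apply ContinuousAt.div
    · fun_prop
    · fun_prop
    · simp [*]
  · norm_num
  · intro m hm
    have : (m:ℝ) ≠ 0 := by positivity
    rw [← mul_div_mul_right (c := ((m:ℝ)⁻¹)^3) _ _ (by positivity)]
    congr 1
    · field_simp
      ring
    · field_simp

lemma jj_shift {d σ θ : ℝ} (hd : 0 < d) (h : NotEven σ) (hs : -1 < σ)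
    (ht : Tendsto (EE d σ) atTop (𝓝 (θ * σ))) :
    jj d (σ + 2) - jj d σ = phi d θ σ + phi d θ (σ + 2) := by
  have s1 := uu_summable hd ht
  have s2 := uu_summable hd (EE_tendsto_shift hd h hs ht)
  have h1 := (s2.hasSum.sub s1.hasSum).tendsto_sum_nat
  have h2 : Tendsto (fun n => ∑ i ∈ Finset.range n, (uu d (σ+2) i - uu d σ i)) atTop
     (𝓝 (-θ * (1 / (σ^2 + d) + 1 / ((σ+2)^2 + d)) - ZZ d σ 0)) := by
    refine ((ZZ_tendsto hd h hs ht).sub_const _).congr fun n => ?_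
    rw [← Finset.sum_range_sub]
    exact Finset.sum_congr rfl fun i _ => (WZ_step d σ hd h hs i).symm
  have h3 := tendsto_nhds_unique h1 h2
  have h8 : σ ≠ 0 := (h.facts hs 0).2.2.2.2.2.2.2
  have e3 : σ + 1 ≠ 0 := by linarith
  have e8 : σ ^ 2 + d ≠ 0 := by positivity
  have e9 : (σ+2) ^ 2 + d ≠ 0 := by positivity
  have e7 : σ + 2 ≠ 0 := by linarith
  have hZ : ZZ d σ 0 = -(1 / (σ * (σ^2+d)) + 1 / ((σ+2)*((σ+2)^2+d))) := by
    simp only [ZZ, EE]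
    simp only [Nat.cast_zero, mul_zero, zero_sub, zero_add, zero_mul, add_zero, mul_one, one_mul, ne_eq, OfNat.ofNat_ne_zero, not_false_eq_true, zero_pow]
    have e10 : 1 + σ ≠ 0 := by linarith
    field_simp
    ring
  unfold jj phi
  rw [h3, hZ]
  field_simp
  ring

/-- iterate -/
lemma NotEven.add_nat {σ : ℝ} (h : NotEven σ) (n : ℕ) : NotEven (σ + 2 * n) := by
  intro k hk
  apply h (k - n)
  push_cast
  linarith

lemma EE_tendsto_nat {d σ θ : ℝ} (hd : 0 < d) (h : NotEven σ) (hs : -1 < σ)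
    (ht : Tendsto (EE d σ) atTop (𝓝 (θ * σ))) (n : ℕ) :
    Tendsto (EE d (σ + 2 * n)) atTop (𝓝 (θ * (σ + 2 * n))) := by
  induction n with
  | zero => simpa using ht
  | succ n ih =>
    have hn : (0:ℝ) ≤ n := Nat.cast_nonneg n
    have := EE_tendsto_shift hd (h.add_nat n) (by linarith) ih
    push_cast
    convert this using 2 <;> ring_nf

lemma jj_nat {d σ θ : ℝ} (hd : 0 < d) (h : NotEven σ) (hs : -1 < σ)
    (ht : Tendsto (EE d σ) atTop (𝓝 (θ * σ))) (n : ℕ) :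
    jj d (σ + 2 * n) - jj d σ = ∑ k ∈ Finset.range n, (phi d θ (σ + 2 * k) + phi d θ (σ + 2 * (k + 1 : ℕ))) := by
  induction n with
  | zero => simp
  | succ n ih =>
    have hn : (0:ℝ) ≤ n := Nat.cast_nonneg n
    have := jj_shift hd (h.add_nat n) (by linarith) (EE_tendsto_nat hd h hs ht n)
    rw [Finset.sum_range_succ, ← ih]
    have e : σ + 2 * ((n+1:ℕ) : ℝ) = σ + 2 * n + 2 := by push_cast; ring
    rw [e, ← this]
    ring

lemma EE_phase1 {d σ : ℝ} (hd : 0 < d) (m : ℕ) (hm : 2 * (m:ℝ) + 2 ≤ σ) :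
    (EE d σ m) ^ 2 * (σ - 2 * m - 1) ≤ (4 * m + 1) ^ 2 * (σ - 1) := by
  induction m with
  | zero => simp [EE]
  | succ m ih =>
    push_cast at hm
    have hm0 : (0:ℝ) ≤ m := Nat.cast_nonneg m
    have ih := ih (by linarith)
    simp only [EE]
    obtain ⟨x, hx⟩ : ∃ x, x = σ - (2 * m + 2) := ⟨_, rfl⟩
    have hx2 : 2 ≤ x := by linarith
    obtain ⟨p, hp⟩ : ∃ p, p = ((2 * (m:ℝ) + 2) ^ 2 + d) / ((2 * (m:ℝ) + 1) ^ 2 + d) := ⟨_, rfl⟩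
    obtain ⟨q, hq⟩ : ∃ q, q = ((2 * (m:ℝ) + 1) ^ 2 - σ^2) / ((2 * (m:ℝ) + 2) ^ 2 - σ^2) := ⟨_, rfl⟩
    have e : (((2 * (m:ℝ) + 2) ^ 2 + d) * ((2 * (m:ℝ) + 1) ^ 2 - σ ^ 2) /
      (((2 * (m:ℝ) + 2) ^ 2 - σ ^ 2) * ((2 * (m:ℝ) + 1) ^ 2 + d))) = p * q := by
      rw [hp, hq, div_mul_div_comm, mul_comm ((2 * (m:ℝ) + 1) ^ 2 + d)]
    rw [e]
    have p0 : 0 ≤ p := by rw [hp]; positivity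
    have hp1 : p * (4 * m + 1) ≤ 4 * m + 5 := by
      rw [hp, div_mul_eq_mul_div, div_le_iff₀ (by positivity)]
      nlinarith
    have hq' : q = ((x + 1) * (σ + 2 * m + 1)) / (x * (σ + 2 * m + 2)) := by
      rw [hq, ← neg_div_neg_eq]
      congr 1 <;> (rw [hx]; ring)
    have q0 : 0 ≤ q := by
      rw [hq']
      have : 0 ≤ σ := by linarith
      positivity
    have hq1 : q * x ≤ x + 1 := by
      rw [hq', div_mul_eq_mul_div, div_le_iff₀ (by apply mul_pos <;> linarith)]
      have : 0 ≤ (x + 1) * x := by nlinarith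
      nlinarith
    have hq2 : q ^ 2 * (x - 1) ≤ x + 1 := by
      have h1 : (q * x)^2 ≤ (x + 1)^2 := by
        have : 0 ≤ q * x := by positivity
        gcongr
      have h2 : q ^ 2 * (x - 1) * x^2 ≤ (x + 1) * x ^ 2 := by
        nlinarith
      exact le_of_mul_le_mul_right h2 (by positivity)
    have hp2 : (p * (4 * m + 1))^2 ≤ (4 * m + 5)^2 := by
      have : 0 ≤ p * (4 * m + 1) := by positivity
      gcongr
    have ih' : EE d σ m ^ 2 * (x + 1) ≤ (4 * m + 1) ^ 2 * (σ - 1) := by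
      rw [hx]; convert ih using 2; ring
    push_cast
    have e2 : σ - 2 * (m + 1) - 1 = x - 1 := by rw [hx]; ring
    rw [e2]
    calc (EE d σ m * (p * q)) ^ 2 * (x - 1) = EE d σ m ^ 2 * p ^ 2 * (q ^ 2 * (x - 1)) := by ring
      _ ≤ EE d σ m ^ 2 * p ^ 2 * (x + 1) := by gcongr
      _ = p ^ 2 * (EE d σ m ^ 2 * (x + 1)) := by ring
      _ ≤ p ^ 2 * ((4 * m + 1) ^ 2 * (σ - 1)) := by gcongr
      _ = (p * (4 * m + 1))^2 * (σ - 1) := by ring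
      _ ≤ (4 * m + 5)^2 * (σ - 1) := by
        have : 0 ≤ σ - 1 := by linarith
        gcongr
      _ = _ := by ring

lemma EE_phase1' {d σ : ℝ} (hd : 0 < d) (m : ℕ) (hm : 2 * (m:ℝ) + 2 ≤ σ) :
    (EE d σ m) ^ 2 ≤ (4 * m + 1) ^ 3 := by
  have h := EE_phase1 hd m hm
  have hm0 : (0:ℝ) ≤ m := Nat.cast_nonneg m
  have h1 : σ - 1 ≤ (4 * m + 1) * (σ - 2 * m - 1) := by nlinarith
  have h2 : (4 * (m:ℝ) + 1) ^ 2 * (σ - 1) ≤ (4 * m + 1) ^ 2 * ((4 * m + 1) * (σ - 2 * m - 1)) := by gcongr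
  have h3 : (EE d σ m) ^ 2 * (σ - 2 * m - 1) ≤ (4 * m + 1) ^ 3 * (σ - 2 * m - 1) := by
    refine h.trans (h2.trans (le_of_eq (by ring)))
  exact le_of_mul_le_mul_right h3 (by linarith)

/-- crude factor bound -/
lemma EE_step_crude {d σ c : ℝ} (hd : 0 < d) (hc : 0 < c) (m : ℕ) (h0 : 0 ≤ σ)
    (h1 : σ - 2 < 2 * m + 2) (h2 : 2 * (m:ℝ) + 2 ≤ σ + 2) (h3 : c ≤ |2 * (m:ℝ) + 2 - σ|) :
    (EE d σ (m+1)) ^ 2 ≤ (12 / c) ^ 2 * (EE d σ m) ^ 2 := by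
  have hm0 : (0:ℝ) ≤ m := Nat.cast_nonneg m
  have key : |((2 * (m:ℝ) + 2) ^ 2 + d) * ((2 * (m:ℝ) + 1) ^ 2 - σ ^ 2) /
      (((2 * (m:ℝ) + 2) ^ 2 - σ ^ 2) * ((2 * (m:ℝ) + 1) ^ 2 + d))| ≤ 12 / c := by
    have a1 : |(2 * (m:ℝ) + 1) ^ 2 - σ ^ 2| ≤ 3 * (2 * m + 2 + σ) := by
      have e : (2 * (m:ℝ) + 1) ^ 2 - σ ^ 2 = (2 * m + 1 - σ) * (2 * m + 1 + σ) := by ring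
      rw [e, abs_mul, abs_of_nonneg (a := 2 * (m:ℝ) + 1 + σ) (by positivity)]
      have : |2 * (m:ℝ) + 1 - σ| ≤ 3 := abs_le.2 ⟨by linarith, by linarith⟩
      gcongr
      linarith
    have a2 : c * (2 * m + 2 + σ) ≤ |(2 * (m:ℝ) + 2) ^ 2 - σ ^ 2| := by
      have e : (2 * (m:ℝ) + 2) ^ 2 - σ ^ 2 = (2 * m + 2 - σ) * (2 * m + 2 + σ) := by ring
      rw [e, abs_mul, abs_of_nonneg (a := 2 * (m:ℝ) + 2 + σ) (by positivity)]
      gcongr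
    have a3 : (2 * (m:ℝ) + 2) ^ 2 + d ≤ 4 * ((2 * (m:ℝ) + 1) ^ 2 + d) := by nlinarith
    rw [abs_div, abs_mul, abs_mul, abs_of_pos (a := (2 * (m:ℝ) + 2) ^ 2 + d) (by positivity),
      abs_of_pos (a := (2 * (m:ℝ) + 1) ^ 2 + d) (by positivity)]
    calc _ ≤ (4 * ((2 * (m:ℝ) + 1) ^ 2 + d)) * (3 * (2 * m + 2 + σ)) / ((c * (2 * m + 2 + σ)) * ((2 * (m:ℝ) + 1) ^ 2 + d)) := by
          gcongr
      _ = 12 / c := by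
        have : 2 * (m:ℝ) + 2 + σ ≠ 0 := by positivity
        have : (2 * (m:ℝ) + 1) ^ 2 + d ≠ 0 := by positivity
        rw [div_eq_div_iff (by positivity) (by positivity)]
        ring
  simp only [EE]
  rw [mul_pow, mul_comm]
  gcongr ?_ * _
  rw [← sq_abs]
  gcongr

lemma EE_step_late {d σ : ℝ} (hd : 0 < d) (m : ℕ) (h0 : 0 ≤ σ) (h1 : σ ≤ 2 * m + 1) :
    (EE d σ (m+1)) ^ 2 ≤ (EE d σ m) ^ 2 := by
  have hm0 : (0:ℝ) ≤ m := Nat.cast_nonneg m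
  have a0 : 0 ≤ (2 * (m:ℝ) + 1) ^ 2 - σ ^ 2 := by nlinarith
  have a1 : 0 < (2 * (m:ℝ) + 2) ^ 2 - σ ^ 2 := by nlinarith
  have key : ((2 * (m:ℝ) + 2) ^ 2 + d) * ((2 * (m:ℝ) + 1) ^ 2 - σ ^ 2) /
      (((2 * (m:ℝ) + 2) ^ 2 - σ ^ 2) * ((2 * (m:ℝ) + 1) ^ 2 + d)) ≤ 1 := by
    rw [div_le_one (by positivity)]
    nlinarith [sq_nonneg σ]
  have key0 : 0 ≤ ((2 * (m:ℝ) + 2) ^ 2 + d) * ((2 * (m:ℝ) + 1) ^ 2 - σ ^ 2) /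
      (((2 * (m:ℝ) + 2) ^ 2 - σ ^ 2) * ((2 * (m:ℝ) + 1) ^ 2 + d)) := by positivity
  simp only [EE]
  rw [mul_pow]
  have := pow_le_one₀ (n := 2) key0 key
  nlinarith [sq_nonneg (EE d σ m)]

lemma EE_bound {d σ c : ℝ} (hd : 0 < d) (hc : 0 < c) (hc1 : c ≤ 1) (h0 : 0 ≤ σ)
    (h3 : ∀ m : ℕ, c ≤ |2 * (m:ℝ) + 2 - σ|) (m : ℕ) :
    (EE d σ m) ^ 2 ≤ (12 / c) ^ 4 * (4 * m + 1) ^ 3 := by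
  have hK : 1 ≤ (12 / c) ^ 2 := by
    apply one_le_pow₀
    rw [le_div_iff₀ hc]; linarith
  have mid : ∀ m : ℕ, 2 * (m:ℝ) ≤ σ → (EE d σ m) ^ 2 ≤ (12 / c) ^ 2 * (4 * m + 1) ^ 3 := by
    intro m hm
    by_cases h : 2 * (m:ℝ) + 2 ≤ σ
    · have := EE_phase1' hd m h
      have h5 : (0:ℝ) ≤ (4 * m + 1) ^ 3 := by positivity
      nlinarith
    · push Not at h
      cases m with
      | zero => simp [EE]; simpa using hK
      | succ m =>
        push_cast at *
        refine (EE_step_crude hd hc m h0 (by linarith) (by linarith) (h3 m)).trans ?_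
        gcongr
        refine (EE_phase1' hd m (by linarith)).trans ?_
        gcongr
        linarith
  have hK4 : (12 / c) ^ 2 ≤ (12 / c) ^ 4 := by nlinarith
  induction m with
  | zero => simp [EE]; linarith
  | succ m ih =>
    by_cases h : 2 * (((m+1:ℕ)):ℝ) ≤ σ
    · refine (mid _ h).trans ?_
      gcongr
    · push Not at h
      push_cast at h ⊢
      by_cases h' : 2 * (m:ℝ) ≤ σ
      · refine (EE_step_crude hd hc m h0 (by linarith) (by linarith) (h3 m)).trans ?_
        calc _ ≤ (12/c)^2 * ((12 / c) ^ 2 * (4 * m + 1) ^ 3) := by gcongr; exact mid m h'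
          _ = (12/c)^4 * (4 * m + 1)^3 := by ring
          _ ≤ _ := by gcongr; linarith
      · push Not at h'
        refine (EE_step_late hd m h0 (by linarith)).trans (ih.trans ?_)
        gcongr
        linarith

lemma uu_bound {d σ c : ℝ} (hd : 0 < d) (hc : 0 < c) (hc1 : c ≤ 1) (h0 : 0 ≤ σ)
    (h3 : ∀ m : ℕ, c ≤ |2 * (m:ℝ) + 2 - σ|) (m : ℕ) :
    |uu d σ m| ≤ 24 * (12 / c) ^ 2 * (1 / ((m + 1 : ℕ) : ℝ) ^ (3 / 2 : ℝ)) := by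
  have hm0 : (0:ℝ) ≤ m := Nat.cast_nonneg m
  have hp : (0:ℝ) < ((m:ℝ) + 1) ^ (3 / 2 : ℝ) := by positivity
  have hsq : (((m:ℝ) + 1) ^ (3 / 2 : ℝ)) ^ 2 = ((m:ℝ) + 1) ^ 3 := by
    rw [← Real.rpow_natCast, ← Real.rpow_mul (by positivity)]
    norm_num
  have key : ∀ E x : ℝ, E ^ 2 ≤ (12 / c) ^ 4 * (4 * m + 5) ^ 3 → (m:ℝ) + 1 ≤ x →
      |E / (x * (x^2 + d))| ≤ 12 * (12 / c) ^ 2 * (1 / ((m + 1 : ℕ) : ℝ) ^ (3 / 2 : ℝ)) := by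
    intro E x hE hx
    have hx0 : 0 < x := by linarith
    have h1 : |E| ≤ 12 * (12 / c) ^ 2 * ((m:ℝ) + 1) ^ (3 / 2 : ℝ) := by
      apply abs_le_of_sq_le_sq _ (by positivity)
      rw [mul_pow, hsq]
      refine hE.trans ?_
      have : (4 * (m:ℝ) + 5)^3 ≤ (5 * (m + 1))^3 := by gcongr; linarith
      have h12 : 0 ≤ (12/c)^4 := by positivity
      have h13 : 0 ≤ ((m:ℝ)+1)^3 := by positivity
      have h14 := mul_le_mul_of_nonneg_left this h12
      nlinarith [mul_nonneg h12 h13]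
    rw [abs_div, abs_of_pos (a := x * (x^2+d)) (by positivity), mul_one_div]
    push_cast
    rw [div_le_div_iff₀ (by positivity) hp]
    calc |E| * ((m:ℝ) + 1) ^ (3 / 2 : ℝ) ≤ 12 * (12 / c) ^ 2 * ((m:ℝ) + 1) ^ (3 / 2 : ℝ) * ((m:ℝ) + 1) ^ (3 / 2 : ℝ) := by gcongr
      _ = 12 * (12 / c) ^ 2 * ((m:ℝ) + 1) ^ 3 := by rw [← hsq]; ring
      _ ≤ 12 * (12 / c) ^ 2 * (x * (x ^ 2 + d)) := by
        gcongr
        calc ((m:ℝ) + 1) ^ 3 ≤ x ^ 3 := by gcongr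
          _ ≤ x * (x^2 + d) := by nlinarith [mul_pos hx0 hd]
  unfold uu
  refine (abs_add_le _ _).trans ?_
  have a1 := key _ (2*m+1) ((EE_bound hd hc hc1 h0 h3 m).trans (by gcongr; norm_num)) (by linarith)
  have a2 := key _ (2*m+2) ((EE_bound hd hc hc1 h0 h3 (m+1)).trans (le_of_eq (by push_cast; ring))) (by linarith)
  linarith

noncomputable def om (d : ℝ) : ℕ → ℝ
  | 0 => 1
  | m + 1 => om d m * (((2 * (m:ℝ) + 2) ^ 2 + d) / ((2 * (m:ℝ) + 1) ^ 2 + d))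

noncomputable def Lam (d : ℝ) : ℝ := ∑' m : ℕ, (om d m / ((2 * (m:ℝ) + 1) * ((2 * (m:ℝ) + 1) ^ 2 + d)) +
  om d (m + 1) / ((2 * (m:ℝ) + 2) * ((2 * (m:ℝ) + 2) ^ 2 + d)))

lemma EE_top (d s : ℝ) (m : ℕ) :
    Tendsto (fun n : ℕ => EE d (s + 2 * n) m) atTop (𝓝 (om d m)) := by
  induction m with
  | zero => simp [EE, om]
  | succ m ih =>
    simp only [EE, om]
    refine ih.mul ?_
    have e : ((2 * (m:ℝ) + 2) ^ 2 + d) / ((2 * (m:ℝ) + 1) ^ 2 + d) =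
      (((2 * (m:ℝ) + 2) ^ 2 + d) / ((2 * (m:ℝ) + 1) ^ 2 + d)) * 1 := by ring
    rw [e]
    have : Tendsto (fun n : ℕ => ((2 * (m:ℝ) + 1) ^ 2 - (s + 2 * n) ^ 2) / ((2 * (m:ℝ) + 2) ^ 2 - (s + 2 * n) ^ 2)) atTop (𝓝 1) := by
      refine tendsto_of_inv (f := fun t => ((2 * (m:ℝ) + 1) ^ 2 * t^2 - (s * t + 2) ^ 2) / ((2 * (m:ℝ) + 2) ^ 2 * t^2 - (s * t + 2) ^ 2)) ?_ ?_ ?_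
      · apply ContinuousAt.div
        · fun_prop
        · fun_prop
        · norm_num
      · norm_num
      · intro n hn
        have : (n:ℝ) ≠ 0 := by positivity
        rw [← mul_div_mul_right (c := ((n:ℝ)⁻¹)^2) _ _ (by positivity)]
        congr 1
        · field_simp
        · field_simp
    refine (this.const_mul _).congr fun n => ?_
    rw [div_mul_div_comm, mul_comm ((2 * (m:ℝ) + 1) ^ 2 + d)]

lemma jj_top {d s : ℝ} (hd : 0 < d) (hs0 : s ≠ 0) (hs1 : -1 < s) (hs2 : s ≤ 1) :
    Tendsto (fun n : ℕ => jj d (s + 2 * n)) atTop (𝓝 (Lam d)) := by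
  have hc : 0 < |s| := abs_pos.2 hs0
  have hc1 : |s| ≤ 1 := abs_le.2 ⟨hs1.le, hs2⟩
  refine tendsto_tsum_of_dominated_convergence (bound := fun m : ℕ => 24 * (12 / |s|) ^ 2 * (1 / ((m + 1 : ℕ) : ℝ) ^ (3 / 2 : ℝ))) ?_ ?_ ?_
  · exact ((summable_nat_add_iff 1 (f := fun m : ℕ => 1 / (m : ℝ) ^ (3 / 2 : ℝ))).2 (Real.summable_one_div_nat_rpow.2 (by norm_num))).mul_left _
  · intro m
    exact ((EE_top d s m).div_const _).add ((EE_top d s (m+1)).div_const _)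
  · filter_upwards [eventually_ge_atTop 1] with n hn m
    have hn' : (1:ℝ) ≤ n := by exact_mod_cast hn
    refine uu_bound hd hc hc1 (by linarith) (fun k => ?_) m
    have e : 2 * (k:ℝ) + 2 - (s + 2 * n) = 2 * (((k:ℤ) + 1 - (n:ℤ) : ℤ) : ℝ) - s := by push_cast; ring
    rw [e]
    generalize (k:ℤ) + 1 - (n:ℤ) = z
    rcases lt_trichotomy z 0 with h | h | h
    · have : (z:ℝ) ≤ -1 := by exact_mod_cast (by omega : z ≤ -1)
      refine hc1.trans ?_
      rw [abs_of_neg (by linarith)]; linarith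
    · subst h; simp
    · have : (1:ℝ) ≤ z := by exact_mod_cast (by omega : 1 ≤ z)
      refine hc1.trans ?_
      rw [abs_of_pos (by linarith)]; linarith

lemma EE_one (d : ℝ) (m : ℕ) : EE d 1 (m + 1) = 0 := by
  induction m with
  | zero => simp [EE]
  | succ m ih => rw [EE, ih, zero_mul]

lemma jj_one (d : ℝ) : jj d 1 = 1 / (1 + d) := by
  unfold jj
  rw [tsum_eq_single 0]
  · simp [uu, EE_one, EE]
  · intro m hm
    obtain ⟨k, rfl⟩ := Nat.exists_eq_succ_of_ne_zero hm
    simp [uu, EE_one]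

lemma notEven_one : NotEven 1 := by
  intro k hk
  have : (1:ℤ) = 2 * k := by exact_mod_cast hk
  omega

lemma notEven_small {y : ℝ} (h0 : y ≠ 0) (h1 : |y| < 1) : NotEven y := by
  intro k hk
  rcases eq_or_ne k 0 with h | h
  · subst h; simp at hk; exact h0 hk
  · have : (1:ℝ) ≤ |(k:ℝ)| := by
      exact_mod_cast Int.one_le_abs h
    rw [hk, abs_mul] at h1
    norm_num at h1
    linarith

lemma phi_tendsto (d θ s : ℝ) (hd : 0 < d) : Tendsto (fun n : ℕ => phi d θ (s + 2 * n)) atTop (𝓝 0) := by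
  unfold phi
  have h1 : Tendsto (fun n : ℕ => s + 2 * (n:ℝ)) atTop atTop :=
    tendsto_atTop_add_const_left _ _ (tendsto_natCast_atTop_atTop.const_mul_atTop two_pos)
  have h2 : Tendsto (fun n : ℕ => 1 / (s + 2 * (n:ℝ)) - θ) atTop (𝓝 (0 - θ)) := by
    simp_rw [one_div]
    exact (tendsto_inv_atTop_zero.comp h1).sub_const _
  have h3 : Tendsto (fun n : ℕ => (s + 2 * (n:ℝ)) ^ 2 + d) atTop atTop :=
    tendsto_atTop_add_const_right _ _ ((tendsto_pow_atTop two_ne_zero).comp h1)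
  exact h2.div_atTop h3

lemma sum_pair (f : ℕ → ℝ) (n : ℕ) : ∑ k ∈ Finset.range n, (f k + f (k+1)) =
    2 * ∑ k ∈ Finset.range n, f k + f n - f 0 := by
  rw [Finset.sum_add_distrib]
  have := Finset.sum_range_succ' f n
  have h2 := Finset.sum_range_succ f n
  linarith

lemma sum_phi_tendsto {d s θ : ℝ} (hd : 0 < d) (hs0 : s ≠ 0) (hs1 : -1 < s) (hs2 : s ≤ 1) (h : NotEven s)
    (ht : Tendsto (EE d s) atTop (𝓝 (θ * s))) :
    Tendsto (fun n : ℕ => ∑ k ∈ Finset.range n, phi d θ (s + 2 * k)) atTop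
      (𝓝 ((Lam d - jj d s + phi d θ s) / 2)) := by
  have h1 := (jj_top hd hs0 hs1 hs2).sub_const (jj d s)
  simp_rw [jj_nat hd h hs1 ht, sum_pair (fun k : ℕ => phi d θ (s + 2 * k))] at h1
  have h2 := ((h1.sub (phi_tendsto d θ s hd)).add_const (phi d θ s)).div_const 2
  simp only [sub_zero] at h2
  refine h2.congr fun n => ?_
  simp
  ring

lemma Lam_tendsto {d : ℝ} (hd : 0 < d) :
    Tendsto (fun n : ℕ => ∑ k ∈ Finset.range n, 1 / ((2 * (k:ℝ) + 1) * ((2 * (k:ℝ) + 1) ^ 2 + d))) atTop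
      (𝓝 (Lam d / 2)) := by
  have ht : Tendsto (EE d 1) atTop (𝓝 (0 * 1)) := by
    rw [zero_mul]
    refine tendsto_const_nhds.congr' ?_
    filter_upwards [eventually_ge_atTop 1] with m hm
    obtain ⟨k, rfl⟩ := Nat.exists_eq_succ_of_ne_zero (by omega : m ≠ 0)
    exact (EE_one d k).symm
  have := sum_phi_tendsto hd one_ne_zero (by norm_num) le_rfl notEven_one ht
  rw [jj_one] at this
  have e : phi d 0 1 = 1 / (1 + d) := by simp [phi]
  rw [e, sub_add_cancel] at this
  refine this.congr fun n => Finset.sum_congr rfl fun k _ => ?_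
  rw [phi, sub_zero, div_div, add_comm 1]

/-- main evaluation of `j(y)` -/
lemma jj_eval {y R : ℝ} (hy0 : 0 < y) (hy1 : y < 1)
    (ht : Tendsto (EE (y^2) y) atTop (𝓝 R)) :
    Tendsto (fun n : ℕ => ∑ k ∈ Finset.range n,
      (2 / ((2 * (k:ℝ) + 1) * ((2 * (k:ℝ) + 1) ^ 2 + y^2))
        - (1 / ((k+1:ℝ) * (4 * (k+1:ℝ)^2 - y^2)) + y^2 / ((k+1:ℝ) * (4 * (k+1:ℝ)^4 + (y^2)^2)))
        - R * (2 * (k+1:ℝ) / (4 * (k+1:ℝ)^4 + (y^2)^2)))) atTop (𝓝 (jj (y^2) y)) := by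
  have hd : 0 < y^2 := by positivity
  have hne := notEven_small hy0.ne' (by rw [abs_of_pos hy0]; exact hy1)
  have e1 : R = (R / y) * y := by field_simp
  have t1 : Tendsto (EE (y^2) y) atTop (𝓝 ((R / y) * y)) := by rwa [← e1]
  have t2 : Tendsto (EE (y^2) (-y)) atTop (𝓝 ((-(R / y)) * (-y))) := by
    have : EE (y^2) (-y) = EE (y^2) y := by ext m; exact EE_neg _ _ _
    rw [this, neg_mul_neg]; exact t1
  have a1 := sum_phi_tendsto hd hy0.ne' (by linarith) hy1.le hne t1
  have a2 := sum_phi_tendsto hd (by linarith) (by linarith) (by linarith) hne.neg t2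
  have hj : jj (y^2) (-y) = jj (y^2) y := by
    unfold jj uu
    simp_rw [EE_neg]
  have hp : phi (y^2) (-(R/y)) (-y) = - phi (y^2) (R/y) y := by
    unfold phi
    rw [neg_sq, ← neg_div]
    congr 1
    rw [div_neg]; ring
  rw [hj, hp] at a2
  have a3 := ((Lam_tendsto hd).const_mul 2).sub ((tendsto_add_atTop_iff_nat 1).2 (a1.add a2))
  have e : 2 * (Lam (y^2) / 2) - ((Lam (y^2) - jj (y^2) y + phi (y^2) (R/y) y) / 2 +
    (Lam (y^2) - jj (y^2) y + - phi (y^2) (R/y) y) / 2) = jj (y^2) y := by ring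
  rw [e] at a3
  refine a3.congr fun n => ?_
  rw [← Finset.sum_add_distrib, Finset.sum_range_succ', Finset.mul_sum]
  simp only [Nat.cast_zero, mul_zero, add_zero, hp, add_neg_cancel]
  rw [← Finset.sum_sub_distrib]
  refine Finset.sum_congr rfl fun k _ => ?_
  unfold phi
  push_cast
  have hk : (0:ℝ) ≤ k := Nat.cast_nonneg k
  generalize hx : (k:ℝ) + 1 = x
  have hx1 : 1 ≤ x := by linarith
  have hkx : (k:ℝ) = x - 1 := by linarith
  have b1 : y + 2 * x ≠ 0 := by positivity
  have b2 : -y + 2 * x ≠ 0 := by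
    have : 0 < -y + 2 * x := by linarith
    exact this.ne'
  have b3 : (y + 2 * x)^2 + y^2 ≠ 0 := by positivity
  have b4 : (-y + 2 * x)^2 + y^2 ≠ 0 := by positivity
  have b5 : 4 * x ^ 2 - y ^ 2 = (y + 2 * x) * (-y + 2 * x) := by ring
  have b6 : 4 * x ^ 4 + (y^2)^2 = ((y + 2 * x)^2 + y^2) * ((-y + 2 * x)^2 + y^2) / 4 := by ring
  have b7 : x ≠ 0 := by positivity
  rw [b5, b6, mul_one_div, sub_sub]
  obtain ⟨p, hp⟩ : ∃ p, p = y + 2 * x := ⟨_, rfl⟩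
  obtain ⟨q, hq⟩ : ∃ p, p = -y + 2 * x := ⟨_, rfl⟩
  have hx' : x = (p + q) / 4 := by rw [hp, hq]; ring
  have hy' : y = (p - q) / 2 := by rw [hp, hq]; ring
  obtain ⟨P, hP⟩ : ∃ P, P = p ^ 2 + y ^ 2 := ⟨_, rfl⟩
  obtain ⟨Q, hQ⟩ : ∃ P, P = q ^ 2 + y ^ 2 := ⟨_, rfl⟩
  rw [← hp] at b1 b3 ⊢
  rw [← hq] at b2 b4 ⊢
  rw [← hP] at b3 ⊢
  rw [← hQ] at b4 ⊢
  have hy0' : y ≠ 0 := hy0.ne'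
  field_simp
  rw [hP, hQ, hx', hy']
  ring


/-- coefficients `r_{k,m}` -/
noncomputable def rr : ℕ → ℕ → ℝ
  | 0, _ => 1
  | m + 1, k => ∑ j ∈ Finset.range k, (-1 : ℝ) ^ (j + 1) / ((j:ℝ) + 1) ^ 2 * (rr m (j + 1) + rr m j)

lemma rr_succ_zero (m : ℕ) : rr (m+1) 0 = 0 := by simp [rr]

lemma rr_diff (m k : ℕ) : rr (m+1) (k+1) - rr (m+1) k =
    (-1 : ℝ) ^ (k + 1) / ((k:ℝ) + 1) ^ 2 * (rr m (k + 1) + rr m k) := by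
  simp only [rr, Finset.sum_range_succ]
  ring

lemma sum_inv_sq_le (k : ℕ) : ∑ j ∈ Finset.range k, 1 / ((j:ℝ) + 1) ^ 2 ≤ 2 - 2 / (2 * (k:ℝ) + 1) := by
  induction k with
  | zero => norm_num
  | succ k ih =>
    rw [Finset.sum_range_succ]
    push_cast
    have hk : (0:ℝ) ≤ k := Nat.cast_nonneg k
    have e : 2 / (2 * (k:ℝ) + 1) - 2 / (2 * ((k:ℝ) + 1) + 1) = 4 / ((2 * (k:ℝ) + 1) * (2 * ((k:ℝ) + 1) + 1)) := by
      rw [div_sub_div _ _ (by positivity) (by positivity)]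
      congr 1
      ring
    have : 1 / ((k:ℝ) + 1) ^ 2 ≤ 4 / ((2 * (k:ℝ) + 1) * (2 * ((k:ℝ) + 1) + 1)) := by
      rw [div_le_div_iff₀ (by positivity) (by positivity)]
      nlinarith
    linarith

lemma rr_bound (m k : ℕ) : |rr m k| ≤ 4 ^ m := by
  induction m generalizing k with
  | zero => simp [rr]
  | succ m ih =>
    rw [rr]
    refine (Finset.abs_sum_le_sum_abs _ _).trans ?_
    calc _ ≤ ∑ j ∈ Finset.range k, 1 / ((j:ℝ) + 1) ^ 2 * (2 * 4 ^ m) := by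
          refine Finset.sum_le_sum fun j _ => ?_
          rw [abs_mul, abs_div, abs_pow, abs_neg, abs_one, one_pow, abs_of_pos (a := ((j:ℝ) + 1) ^ 2) (by positivity)]
          gcongr
          refine (abs_add_le _ _).trans ?_
          linarith [ih (j+1), ih j]
      _ = (∑ j ∈ Finset.range k, 1 / ((j:ℝ) + 1) ^ 2) * (2 * 4 ^ m) := by rw [Finset.sum_mul]
      _ ≤ 2 * (2 * 4 ^ m) := by
        gcongr
        refine (sum_inv_sq_le k).trans ?_
        have : 0 ≤ 2 / (2 * (k:ℝ) + 1) := by positivity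
        linarith
      _ = 4 ^ (m+1) := by ring

noncomputable def rho (x : ℝ) : ℕ → ℝ
  | 0 => 1
  | k + 1 => rho x k * ((x - k) / (x + k + 1))

lemma rho_succ {x : ℝ} (hx : 0 ≤ x) (k : ℕ) : rho x (k+1) * (x + k + 1) = rho x k * (x - k) := by
  have : x + k + 1 ≠ 0 := by positivity
  rw [rho]
  field_simp

lemma rho_shift {x : ℝ} (hx : 0 ≤ x) (k : ℕ) : rho x k * (x + 1)^2 = rho (x + 1) k * ((x+1)^2 - k^2) := by
  induction k with
  | zero => simp [rho]
  | succ k ih =>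
    have h1 : x + k + 1 ≠ 0 := by positivity
    have h2 : x + 1 + k + 1 ≠ 0 := by positivity
    simp only [rho]
    push_cast
    rw [mul_right_comm, ih]
    field_simp
    ring

lemma rho_eq_zero (N k : ℕ) (h : N < k) : rho N k = 0 := by
  induction k with
  | zero => omega
  | succ k ih =>
    rcases eq_or_ne N k with h1 | h1
    · subst h1; simp [rho]
    · rw [rho, ih (by omega), zero_mul]

lemma rho_mem (N k : ℕ) : 0 ≤ rho N k ∧ rho N k ≤ 1 := by
  by_cases h : N < k
  · rw [rho_eq_zero N k h]; norm_num
  · induction k with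
    | zero => simp [rho]
    | succ k ih =>
      obtain ⟨h1, h2⟩ := ih (by omega)
      have hk : (k:ℝ) + 1 ≤ N := by exact_mod_cast (by omega : k + 1 ≤ N)
      have h0 : (0:ℝ) ≤ k := Nat.cast_nonneg k
      have a0 : 0 ≤ ((N:ℝ) - k) / (N + k + 1) := by
        apply div_nonneg <;> linarith
      have a1 : ((N:ℝ) - k) / (N + k + 1) ≤ 1 := by
        rw [div_le_one (by positivity)]; linarith
      rw [rho]
      exact ⟨mul_nonneg h1 a0, mul_le_one₀ h2 a0 a1⟩

lemma rho_tendsto (k : ℕ) : Tendsto (fun N : ℕ => rho N k) atTop (𝓝 1) := by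
  induction k with
  | zero => simp [rho]
  | succ k ih =>
    simp only [rho]
    have : Tendsto (fun N : ℕ => ((N:ℝ) - k) / (N + k + 1)) atTop (𝓝 1) := by
      refine tendsto_of_inv (f := fun t => (1 - k * t) / (1 + k * t + t)) ?_ (by simp) ?_
      · apply ContinuousAt.div
        · fun_prop
        · fun_prop
        · norm_num
      · intro m hm
        have : (m:ℝ) ≠ 0 := by positivity
        rw [← mul_div_mul_right (c := ((m:ℝ)⁻¹)) _ _ (by positivity)]
        congr 1
        · field_simp
        · field_simp
    simpa using ih.mul this

lemma rho_abel (N : ℕ) (z : ℕ → ℝ) :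
    (N:ℝ) * ∑ k ∈ Finset.range N, rho N (k+1) * (z (k+1) - z k)
      = ∑ k ∈ Finset.range N, (k+1) * rho N (k+1) * (z (k+1) + z k) - N * z 0 := by
  have hN : (0:ℝ) ≤ N := Nat.cast_nonneg N
  have h := Finset.sum_range_sub (fun k : ℕ => rho N k * (N - k) * z k) N
  simp only [sub_self, mul_zero, zero_mul, Nat.cast_zero, sub_zero] at h
  have e : rho N 0 = 1 := rfl
  rw [e, one_mul, zero_sub] at h
  rw [sub_eq_add_neg, ← h, Finset.mul_sum, ← Finset.sum_add_distrib]
  refine Finset.sum_congr rfl fun k _ => ?_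
  have := rho_succ hN k
  push_cast
  rw [← this]
  ring

lemma rho_diff (N k : ℕ) : rho ((N+1:ℕ):ℝ) k - rho N k = rho ((N+1:ℕ):ℝ) k * k^2 / ((N:ℝ)+1)^2 := by
  have := rho_shift (Nat.cast_nonneg (α := ℝ) N) k
  have h : (N:ℝ) + 1 ≠ 0 := by positivity
  push_cast
  rw [eq_div_iff (by positivity)]
  linarith

/-- differencing a weighted sum -/
lemma rho_sum_diff (N : ℕ) (f : ℕ → ℝ) :
    ∑ k ∈ Finset.range (N+1), rho ((N+1:ℕ):ℝ) (k+1) * f k - ∑ k ∈ Finset.range N, rho N (k+1) * f k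
    = (1 / ((N:ℝ)+1)^2) * ∑ k ∈ Finset.range (N+1), rho ((N+1:ℕ):ℝ) (k+1) * ((k+1)^2 * f k) := by
  have : ∑ k ∈ Finset.range N, rho N (k+1) * f k = ∑ k ∈ Finset.range (N+1), rho N (k+1) * f k := by
    rw [Finset.sum_range_succ, rho_eq_zero N (N+1) (by omega)]; simp
  rw [this, ← Finset.sum_sub_distrib, Finset.mul_sum]
  refine Finset.sum_congr rfl fun k _ => ?_
  rw [← sub_mul, rho_diff]
  push_cast
  ring

noncomputable def FA (n N : ℕ) : ℝ := -∑ k ∈ Finset.range N, rho N (k+1) * (rr (2*n+1) (k+1) - rr (2*n+1) k)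
noncomputable def FB (n N : ℕ) : ℝ := -∑ k ∈ Finset.range N, rho N (k+1) * ((rr (2*n+1) (k+1) + rr (2*n+1) k) / ((k:ℝ)+1))
noncomputable def FC (n N : ℕ) : ℝ := -∑ k ∈ Finset.range N, rho N (k+1) * ((rr (2*n+1) (k+1) + rr (2*n+1) k) / ((k:ℝ)+1)^3)

lemma FB_diff (n N : ℕ) : FB n (N+1) - FB n N = FA n (N+1) / ((N:ℝ)+1) := by
  have h := rho_sum_diff N (fun k => (rr (2*n+1) (k+1) + rr (2*n+1) k) / ((k:ℝ)+1))
  have h2 := rho_abel (N+1) (rr (2*n+1))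
  rw [rr_succ_zero, mul_zero, sub_zero] at h2
  have e : FB n (N+1) - FB n N = - (∑ k ∈ Finset.range (N+1), rho ((N+1:ℕ):ℝ) (k+1) * ((rr (2*n+1) (k+1) + rr (2*n+1) k) / ((k:ℝ)+1)) - ∑ k ∈ Finset.range N, rho N (k+1) * ((rr (2*n+1) (k+1) + rr (2*n+1) k) / ((k:ℝ)+1))) := by
    unfold FB; ring
  rw [e, h]
  have e2 : ∑ k ∈ Finset.range (N+1), rho ((N+1:ℕ):ℝ) (k+1) * (((k:ℝ)+1)^2 * ((rr (2*n+1) (k+1) + rr (2*n+1) k) / ((k:ℝ)+1))) = ∑ k ∈ Finset.range (N+1), (k+1) * rho ((N+1:ℕ):ℝ) (k+1) * (rr (2*n+1) (k+1) + rr (2*n+1) k) := by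
    refine Finset.sum_congr rfl fun k _ => ?_
    have : (k:ℝ) + 1 ≠ 0 := by positivity
    field_simp
  rw [e2, ← h2]
  unfold FA
  have : (N:ℝ) + 1 ≠ 0 := by positivity
  push_cast
  field_simp

lemma FC_diff (n N : ℕ) : FC n (N+1) - FC n N = FB n (N+1) / ((N:ℝ)+1)^2 := by
  have h := rho_sum_diff N (fun k => (rr (2*n+1) (k+1) + rr (2*n+1) k) / ((k:ℝ)+1)^3)
  have e : FC n (N+1) - FC n N = - (∑ k ∈ Finset.range (N+1), rho ((N+1:ℕ):ℝ) (k+1) * ((rr (2*n+1) (k+1) + rr (2*n+1) k) / ((k:ℝ)+1)^3) - ∑ k ∈ Finset.range N, rho N (k+1) * ((rr (2*n+1) (k+1) + rr (2*n+1) k) / ((k:ℝ)+1)^3)) := by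
    unfold FC; ring
  rw [e, h]
  unfold FB
  rw [← mul_neg, one_div, inv_mul_eq_div]
  congr 2
  refine Finset.sum_congr rfl fun k _ => ?_
  have : (k:ℝ) + 1 ≠ 0 := by positivity
  field_simp

lemma FA_aux (n N : ℕ) : FA n (N+1) - FA n N = - (1 / ((N:ℝ)+1)^2) *
    ∑ k ∈ Finset.range (N+1), rho ((N+1:ℕ):ℝ) (k+1) * ((-1)^(k+1) * rr (2*n) (k+1) - (-1)^k * rr (2*n) k) := by
  have h := rho_sum_diff N (fun k => (rr (2*n+1) (k+1) - rr (2*n+1) k))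
  have e : FA n (N+1) - FA n N = - (∑ k ∈ Finset.range (N+1), rho ((N+1:ℕ):ℝ) (k+1) * (rr (2*n+1) (k+1) - rr (2*n+1) k) - ∑ k ∈ Finset.range N, rho N (k+1) * (rr (2*n+1) (k+1) - rr (2*n+1) k)) := by
    unfold FA; ring
  rw [e, h, neg_mul]
  congr 2
  refine Finset.sum_congr rfl fun k _ => ?_
  rw [rr_diff]
  have : (k:ℝ) + 1 ≠ 0 := by positivity
  field_simp
  ring

lemma FA_diff_zero (N : ℕ) : FA 0 (N+1) - FA 0 N = 1 / ((N:ℝ)+1)^2 := by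
  rw [FA_aux]
  have h2 := rho_abel (N+1) (fun k => (-1)^k)
  have e1 : ∀ k : ℕ, rr (2*0) k = 1 := fun k => by simp [rr]
  simp only [e1, mul_one]
  have e2 : ∑ k ∈ Finset.range (N+1), ((k:ℝ)+1) * rho ((N+1:ℕ):ℝ) (k+1) * ((-1)^(k+1) + (-1)^k) = 0 := by
    apply Finset.sum_eq_zero
    intro k _
    ring
  rw [e2] at h2
  have h3 : ((N+1:ℕ):ℝ) ≠ 0 := by positivity
  have h4 : ∑ k ∈ Finset.range (N+1), rho ((N+1:ℕ):ℝ) (k+1) * ((-1)^(k+1) - (-1)^k) = -1 := by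
    apply mul_left_cancel₀ h3
    rw [h2]; ring
  rw [h4]; ring

lemma FA_diff_succ (n N : ℕ) : FA (n+1) (N+1) - FA (n+1) N = FB n (N+1) / ((N:ℝ)+1)^3 := by
  rw [FA_aux]
  have h2 := rho_abel (N+1) (fun k => (-1)^k * rr (2*(n+1)) k)
  have e0 : rr (2*(n+1)) 0 = 0 := rr_succ_zero (2*n+1)
  rw [e0] at h2
  simp only [mul_zero, sub_zero] at h2
  have e2 : ∑ k ∈ Finset.range (N+1), ((k:ℝ)+1) * rho ((N+1:ℕ):ℝ) (k+1) * ((-1)^(k+1) * rr (2*(n+1)) (k+1) + (-1)^k * rr (2*(n+1)) k) = - FB n (N+1) := by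
    unfold FB
    rw [neg_neg]
    refine Finset.sum_congr rfl fun k _ => ?_
    have h := rr_diff (2*n+1) k
    have h' : rr (2*(n+1)) (k+1) - rr (2*(n+1)) k = (-1 : ℝ) ^ (k + 1) / ((k:ℝ) + 1) ^ 2 * (rr (2*n+1) (k + 1) + rr (2*n+1) k) := h
    have e3 : (-1:ℝ)^(k+1) * rr (2*(n+1)) (k+1) + (-1)^k * rr (2*(n+1)) k = (-1)^(k+1) * (rr (2*(n+1)) (k+1) - rr (2*(n+1)) k) := by ring
    rw [e3, h']
    have : (k:ℝ) + 1 ≠ 0 := by positivity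
    have h5 : (-1:ℝ)^(k+1) * (-1)^(k+1) = 1 := by rw [← mul_pow]; norm_num
    calc _ = ((-1:ℝ)^(k+1) * (-1)^(k+1)) * (((k:ℝ)+1) * rho ((N+1:ℕ):ℝ) (k+1) * (1 / ((k:ℝ) + 1) ^ 2 * (rr (2*n+1) (k + 1) + rr (2*n+1) k))) := by ring
      _ = _ := by rw [h5]; field_simp
  rw [e2] at h2
  have h3 : ((N:ℝ)+1) ≠ 0 := by positivity
  push_cast at h2 ⊢
  have h4 : FB n (N+1) = - (((N:ℝ)+1) * ∑ k ∈ Finset.range (N+1), rho ((N:ℝ)+1) (k+1) * ((-1)^(k+1) * rr (2*(n+1)) (k+1) - (-1)^k * rr (2*(n+1)) k)) := by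
    linarith
  rw [h4]
  field_simp

noncomputable def gg (m : ℕ) : ℝ := ∑' k : ℕ, (rr m (k+1) + rr m k) / ((k:ℝ)+1)^3

lemma gg_term_bound (m k : ℕ) : |(rr m (k+1) + rr m k) / ((k:ℝ)+1)^3| ≤ 2 * 4^m * (1 / ((k+1:ℕ):ℝ)^3) := by
  rw [abs_div, abs_of_pos (a := ((k:ℝ)+1)^3) (by positivity), mul_one_div]
  push_cast
  gcongr
  refine (abs_add_le _ _).trans ?_
  linarith [rr_bound m (k+1), rr_bound m k]

lemma summable_cube : Summable (fun k : ℕ => 1 / ((k+1:ℕ):ℝ)^3) :=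
  (summable_nat_add_iff 1 (f := fun k : ℕ => 1 / (k:ℝ)^3)).2 (Real.summable_one_div_nat_pow.2 (by norm_num))

lemma FC_tendsto (n : ℕ) : Tendsto (FC n) atTop (𝓝 (-gg (2*n+1))) := by
  have h1 : ∀ N, FC n N = -∑' k : ℕ, rho N (k+1) * ((rr (2*n+1) (k+1) + rr (2*n+1) k) / ((k:ℝ)+1)^3) := by
    intro N
    rw [tsum_eq_sum (s := Finset.range N)]
    · rfl
    · intro k hk
      rw [rho_eq_zero N (k+1) (by simp at hk; omega), zero_mul]
  have h2 : FC n = fun N : ℕ => -∑' k : ℕ, rho N (k+1) * ((rr (2*n+1) (k+1) + rr (2*n+1) k) / ((k:ℝ)+1)^3) := funext h1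
  rw [h2]
  apply Tendsto.neg
  refine tendsto_tsum_of_dominated_convergence (bound := fun k : ℕ => 2 * 4^(2*n+1) * (1 / ((k+1:ℕ):ℝ)^3)) (summable_cube.mul_left _) ?_ ?_
  · intro k
    simpa using (rho_tendsto (k+1)).mul_const _
  · refine Eventually.of_forall fun N k => ?_
    rw [norm_mul]
    have := rho_mem N (k+1)
    have h3 : ‖rho N (k+1)‖ ≤ 1 := by
      rw [Real.norm_eq_abs, abs_of_nonneg this.1]; exact this.2
    have h4 := gg_term_bound (2*n+1) k
    calc _ ≤ 1 * ‖(rr (2*n+1) (k+1) + rr (2*n+1) k) / ((k:ℝ)+1)^3‖ := by gcongr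
      _ ≤ _ := by rw [one_mul]; exact h4


open scoped ENNReal in
noncomputable def wE {d : ℕ} (s : Fin d → ℕ) (g : Fin d → ℕ) : ℝ≥0∞ :=
  ∏ i, ((idxSeq g i : ℝ≥0∞) ^ s i)⁻¹

open scoped ENNReal in
noncomputable def cc : (d : ℕ) → (Fin d → ℕ) → ℕ → ℝ≥0∞
  | 0, _, m => if m = 0 then 1 else 0
  | d + 1, s, m => (((m + 1 : ℕ) : ℝ≥0∞) ^ s (Fin.last d))⁻¹ *
      ∑ j ∈ Finset.range (m + 1), cc d (fun i => s i.castSucc) j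

lemma idxSeq_castSucc {d : ℕ} (g : Fin (d+1) → ℕ) (i : Fin d) :
    idxSeq g i.castSucc = idxSeq (fun j : Fin d => g j.castSucc) i := by
  unfold idxSeq
  congr 1
  rw [Finset.sum_filter, Finset.sum_filter, Fin.sum_univ_castSucc]
  simp [Fin.castSucc_le_castSucc_iff, Fin.last_le_iff, Fin.castSucc_ne_last]

lemma idxSeq_last {d : ℕ} (g : Fin (d+1) → ℕ) :
    idxSeq g (Fin.last d) = ∑ i, g i + 1 := by
  unfold idxSeq
  rw [add_comm]
  congr 1
  rw [Finset.filter_true_of_mem]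
  intro x _
  exact Fin.le_last x

open scoped ENNReal in
lemma tsum_antidiag (f ψ : ℕ → ℝ≥0∞) : ∑' j, f j * ∑' a, ψ (j + a) =
    ∑' m, ψ m * ∑ j ∈ Finset.range (m+1), f j := by
  simp_rw [← ENNReal.tsum_mul_left]
  rw [← ENNReal.tsum_prod (f := fun j a => f j * ψ (j + a)),
    ← (Finset.HasAntidiagonal.sigmaAntidiagonalEquivProd (A := ℕ)).tsum_eq, ENNReal.tsum_sigma']
  refine tsum_congr fun m => ?_
  have hA := Finset.Nat.sum_antidiagonal_eq_sum_range_succ (fun i _ => ψ m * f i) m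
  rw [tsum_fintype, Finset.mul_sum, ← hA,
    ← Finset.sum_coe_sort (Finset.HasAntidiagonal.antidiagonal m) (fun p => ψ m * f p.1)]
  refine Finset.sum_congr rfl fun p _ => ?_
  have := p.2
  rw [Finset.HasAntidiagonal.mem_antidiagonal] at this
  simp only [Finset.HasAntidiagonal.sigmaAntidiagonalEquivProd_apply]
  rw [this, mul_comm]

open scoped ENNReal in
lemma tsum_wE (d : ℕ) : ∀ (s : Fin d → ℕ) (φ : ℕ → ℝ≥0∞),
    ∑' g : Fin d → ℕ, wE s g * φ (∑ i, g i) = ∑' m, cc d s m * φ m := by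
  induction d with
  | zero =>
    intro s φ
    rw [tsum_fintype]
    rw [tsum_eq_single 0]
    · simp [wE, cc]
    · intro m hm
      simp [cc, hm]
  | succ d ih =>
    intro s φ
    rw [← (Fin.snocEquiv (fun _ : Fin (d+1) => ℕ)).tsum_eq, ENNReal.tsum_prod', ENNReal.tsum_comm]
    have h1 : ∀ (g : Fin d → ℕ) (a : ℕ), wE s ((Fin.snocEquiv (fun _ : Fin (d+1) => ℕ)) (a, g)) *
        φ (∑ i, (Fin.snocEquiv (fun _ : Fin (d+1) => ℕ)) (a, g) i) =
        wE (fun i => s i.castSucc) g * ((((∑ i, g i + a + 1 : ℕ) : ℝ≥0∞) ^ s (Fin.last d))⁻¹ * φ (∑ i, g i + a)) := by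
      intro g a
      have e : (Fin.snocEquiv (fun _ : Fin (d+1) => ℕ)) (a, g) = (Fin.snoc g a : Fin (d+1) → ℕ) := rfl
      rw [e, wE, Fin.prod_univ_castSucc]
      simp only [idxSeq_castSucc, idxSeq_last, Fin.sum_univ_castSucc, Fin.snoc_castSucc, Fin.snoc_last]
      rw [mul_assoc]
      rfl
    simp_rw [h1, ENNReal.tsum_mul_left]
    rw [ih (fun i => s i.castSucc) (fun j => ∑' a, (((j + a + 1 : ℕ) : ℝ≥0∞) ^ s (Fin.last d))⁻¹ * φ (j + a)),
      tsum_antidiag _ (fun m => (((m + 1 : ℕ) : ℝ≥0∞) ^ s (Fin.last d))⁻¹ * φ m)]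
    refine tsum_congr fun m => ?_
    rw [cc]
    ring

lemma cc_step {d : ℕ} (s : Fin d → ℕ) (e : ℕ) (F G : ℕ → ℝ)
    (hF : ∀ N, 0 ≤ F (N+1)) (hs : ∀ N, ∑ j ∈ Finset.range (N+1), cc d s j = ENNReal.ofReal (F (N+1)))
    (hG0 : G 0 = 0) (hG : ∀ N : ℕ, G (N+1) - G N = F (N+1) / ((N:ℝ)+1)^e) :
    (∀ N, 0 ≤ G N) ∧ ∀ N, ∑ j ∈ Finset.range N, cc (d+1) (Fin.snoc s e : Fin (d+1) → ℕ) j = ENNReal.ofReal (G N) := by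
  have h1 : ∀ N, 0 ≤ G N := by
    intro N
    induction N with
    | zero => rw [hG0]
    | succ N ih =>
      have := hG N
      have h2 : 0 ≤ F (N+1) / ((N:ℝ)+1)^e := div_nonneg (hF N) (by positivity)
      linarith
  refine ⟨h1, fun N => ?_⟩
  induction N with
  | zero => simp [hG0]
  | succ N ih =>
    rw [Finset.sum_range_succ, ih, cc]
    simp only [Fin.snoc_last, Fin.snoc_castSucc]
    rw [hs N]
    have : G (N+1) = G N + F (N+1) / ((N:ℝ)+1)^e := by linarith [hG N]
    rw [this, ENNReal.ofReal_add (h1 N) (div_nonneg (hF N) (by positivity)), ENNReal.ofReal_div_of_pos (by positivity),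
      mul_comm, ENNReal.div_eq_inv_mul, mul_comm]
    congr 3
    rw [ENNReal.ofReal_pow (by positivity)]
    congr 1
    rw [← Nat.cast_succ, ENNReal.ofReal_natCast]

lemma pat13_succ (n : ℕ) : pat13 (n+1) = (Fin.snoc (Fin.snoc (pat13 n) 1 : Fin (2*n+1) → ℕ) 3 : Fin (2*n+2) → ℕ) := by
  have key : ∀ i : Fin (2*n+1+1), (if (i:ℕ) % 2 = 0 then 1 else 3) =
      (Fin.snoc (Fin.snoc (pat13 n) 1 : Fin (2*n+1) → ℕ) 3 : Fin (2*n+1+1) → ℕ) i := by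
    intro i
    refine Fin.lastCases ?_ (fun i => ?_) i
    · rw [Fin.snoc_last, Fin.val_last, if_neg (by omega)]
    · rw [Fin.snoc_castSucc]
      refine Fin.lastCases ?_ (fun i => ?_) i
      · rw [Fin.snoc_last]
        simp
      · rw [Fin.snoc_castSucc]
        simp [pat13]
  exact funext key

lemma cc_A (n : ℕ) : (∀ N, 0 ≤ FA n N) ∧ ∀ N, ∑ j ∈ Finset.range N,
    cc (2*n+1) (Fin.cons 2 (pat13 n) : Fin (2*n+1) → ℕ) j = ENNReal.ofReal (FA n N) := by
  induction n with
  | zero =>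
    have e : (Fin.cons 2 (pat13 0) : Fin (2*0+1) → ℕ) = (Fin.snoc (Fin.elim0 : Fin 0 → ℕ) 2 : Fin 1 → ℕ) := by
      funext i
      have : i = (0 : Fin 1) := Subsingleton.elim (α := Fin 1) _ _
      subst this
      rfl
    rw [e]
    refine cc_step (d := 0) _ 2 (fun _ => 1) _ (fun N => zero_le_one) ?_ (by simp [FA]) (fun N => by rw [FA_diff_zero])
    intro N
    simp [cc]
  | succ n ih =>
    have e : (Fin.cons 2 (pat13 (n+1)) : Fin (2*(n+1)+1) → ℕ) =
      (Fin.snoc (Fin.snoc (Fin.cons 2 (pat13 n) : Fin (2*n+1) → ℕ) 1 : Fin (2*n+2) → ℕ) 3 : Fin (2*n+3) → ℕ) := by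
      rw [pat13_succ]
      rw [← Fin.cons_snoc_eq_snoc_cons, ← Fin.cons_snoc_eq_snoc_cons]
    rw [e]
    have h1 := cc_step _ 1 (FA n) (FB n) (fun N => ih.1 _) (fun N => ih.2 _) (by simp [FB]) (fun N => by rw [FB_diff, pow_one])
    exact cc_step _ 3 (FB n) (FA (n+1)) (fun N => h1.1 _) (fun N => h1.2 _) (by simp [FA]) (fun N => FA_diff_succ n N)

lemma cc_C (n : ℕ) : (∀ N, 0 ≤ FC n N) ∧ ∀ N, ∑ j ∈ Finset.range N,
    cc (2*n+3) (Fin.cons 2 (Fin.snoc (Fin.snoc (pat13 n) 1 : Fin (2*n+1) → ℕ) 2 : Fin (2*n+2) → ℕ) : Fin (2*n+3) → ℕ) j = ENNReal.ofReal (FC n N) := by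
  rw [Fin.cons_snoc_eq_snoc_cons, Fin.cons_snoc_eq_snoc_cons]
  have ih := cc_A n
  have h1 := cc_step _ 1 (FA n) (FB n) (fun N => ih.1 _) (fun N => ih.2 _) (by simp [FB]) (fun N => by rw [FB_diff, pow_one])
  exact cc_step _ 2 (FB n) (FC n) (fun N => h1.1 _) (fun N => h1.2 _) (by simp [FC]) (fun N => FC_diff n N)

lemma zetaStar_eq_gg (n : ℕ) :
    zetaStar (Fin.cons 2 (Fin.snoc (Fin.snoc (pat13 n) 1) 2)) = - gg (2*n+1) := by
  obtain ⟨h1, h2⟩ := cc_C n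
  have h3 := FC_tendsto n
  have h4 : 0 ≤ - gg (2*n+1) := ge_of_tendsto' h3 h1
  have h5 : ∑' m, cc (2*n+3) (Fin.cons 2 (Fin.snoc (Fin.snoc (pat13 n) 1 : Fin (2*n+1) → ℕ) 2 : Fin (2*n+2) → ℕ) : Fin (2*n+3) → ℕ) m = ENNReal.ofReal (- gg (2*n+1)) := by
    have a1 := ENNReal.tendsto_nat_tsum (cc (2*n+3) (Fin.cons 2 (Fin.snoc (Fin.snoc (pat13 n) 1 : Fin (2*n+1) → ℕ) 2 : Fin (2*n+2) → ℕ) : Fin (2*n+3) → ℕ))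
    simp_rw [h2] at a1
    exact tendsto_nhds_unique a1 ((ENNReal.continuous_ofReal.tendsto _).comp h3)
  have h6 := tsum_wE (2*n+3) (Fin.cons 2 (Fin.snoc (Fin.snoc (pat13 n) 1 : Fin (2*n+1) → ℕ) 2 : Fin (2*n+2) → ℕ) : Fin (2*n+3) → ℕ) (fun _ => 1)
  simp only [mul_one] at h6
  rw [h5] at h6
  unfold zetaStar
  have h7 : ∀ g : Fin (2*n+3) → ℕ, ∏ i, 1 / (idxSeq g i : ℝ) ^ ((Fin.cons 2 (Fin.snoc (Fin.snoc (pat13 n) 1 : Fin (2*n+1) → ℕ) 2 : Fin (2*n+2) → ℕ) : Fin (2*n+3) → ℕ) i) =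
     (wE (Fin.cons 2 (Fin.snoc (Fin.snoc (pat13 n) 1 : Fin (2*n+1) → ℕ) 2 : Fin (2*n+2) → ℕ) : Fin (2*n+3) → ℕ) g).toReal := by
    intro g
    rw [wE, ENNReal.toReal_prod]
    refine Finset.prod_congr rfl fun i _ => ?_
    rw [ENNReal.toReal_inv, ENNReal.toReal_pow, ENNReal.toReal_natCast, one_div]
  refine (tsum_congr h7).trans ?_
  rw [← ENNReal.tsum_toReal_eq, h6, ENNReal.toReal_ofReal h4]
  intro g hg
  exact ENNReal.ne_top_of_tsum_ne_top (h6 ▸ ENNReal.ofReal_ne_top) g hg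


noncomputable def RR (κ : ℝ) (k : ℕ) : ℝ := ∑' m, rr m k * κ ^ m

lemma rr_term_le {κ : ℝ} (h0 : 0 ≤ κ) (h1 : κ ≤ 1/8) (k m : ℕ) : |rr m k * κ ^ m| ≤ (1/2) ^ m := by
  rw [abs_mul, abs_of_nonneg (a := κ ^ m) (by positivity)]
  calc _ ≤ (4:ℝ) ^ m * (1/8) ^ m := by gcongr; exact rr_bound m k
    _ = (1/2)^m := by rw [← mul_pow]; norm_num

lemma rr_summable {κ : ℝ} (h0 : 0 ≤ κ) (h1 : κ ≤ 1/8) (k : ℕ) : Summable (fun m => rr m k * κ ^ m) :=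
  Summable.of_norm_bounded summable_geometric_two fun m => rr_term_le h0 h1 k m

lemma RR_bound {κ : ℝ} (h0 : 0 ≤ κ) (h1 : κ ≤ 1/8) (k : ℕ) : |RR κ k| ≤ 2 := by
  have := tsum_of_norm_bounded (f := fun m => rr m k * κ ^ m) hasSum_geometric_two fun m => rr_term_le h0 h1 k m
  exact this

lemma RR_zero (κ : ℝ) : RR κ 0 = 1 := by
  unfold RR
  rw [tsum_eq_single 0]
  · simp [rr]
  · intro m hm
    obtain ⟨j, rfl⟩ := Nat.exists_eq_succ_of_ne_zero hm
    simp [rr_succ_zero]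

lemma RR_rec {κ : ℝ} (h0 : 0 ≤ κ) (h1 : κ ≤ 1/8) (k : ℕ) :
    RR κ (k+1) - RR κ k = (-1 : ℝ) ^ (k + 1) / ((k:ℝ) + 1) ^ 2 * κ * (RR κ (k+1) + RR κ k) := by
  have s1 := rr_summable h0 h1 (k+1)
  have s2 := rr_summable h0 h1 k
  unfold RR
  rw [← s1.tsum_sub s2, ← s1.tsum_add s2, (s1.sub s2).tsum_eq_zero_add, ← tsum_mul_left]
  have e : rr 0 (k+1) * κ ^ 0 - rr 0 k * κ ^ 0 = 0 := by simp [rr]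
  rw [e, zero_add]
  refine tsum_congr fun m => ?_
  rw [← sub_mul, rr_diff]
  ring

lemma RR_even {y : ℝ} (h1 : y ^ 2 ≤ 1/8) (m : ℕ) :
    RR (y^2) (2*m) = EE (y^2) y m ∧ RR (y^2) (2*m+1) * ((2*(m:ℝ)+1)^2 + y^2) = EE (y^2) y m * ((2*(m:ℝ)+1)^2 - y^2)
    ∧ RR (y^2) (2*m+1) * ((2*(m:ℝ)+2)^2 + y^2) = EE (y^2) y (m+1) * ((2*(m:ℝ)+2)^2 - y^2) := by
  have h0 : 0 ≤ y^2 := by positivity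
  have hodd : ∀ m : ℕ, RR (y^2) (2*m+1) * ((2*(m:ℝ)+1)^2 + y^2) = RR (y^2) (2*m) * ((2*(m:ℝ)+1)^2 - y^2) := by
    intro m
    have := RR_rec h0 h1 (2*m)
    have e : (-1:ℝ)^(2*m+1) = -1 := by rw [pow_succ, pow_mul]; norm_num
    rw [e] at this
    push_cast at this
    have h : (2*(m:ℝ)+1) ≠ 0 := by positivity
    field_simp at this
    linarith
  have heven : ∀ m : ℕ, RR (y^2) (2*(m+1)) * ((2*(m:ℝ)+2)^2 - y^2) = RR (y^2) (2*m+1) * ((2*(m:ℝ)+2)^2 + y^2) := by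
    intro m
    have := RR_rec h0 h1 (2*m+1)
    have e : (-1:ℝ)^(2*m+1+1) = 1 := by rw [show 2*m+1+1 = 2*(m+1) by ring, pow_mul]; norm_num
    rw [e] at this
    push_cast at this
    have h : (2*(m:ℝ)+1+1) ≠ 0 := by positivity
    rw [div_mul_eq_mul_div, div_mul_eq_mul_div, eq_div_iff (by positivity)] at this
    have e2 : 2*(m+1) = 2*m+1+1 := by ring
    rw [e2]
    linarith
  have hm0 : ∀ m : ℕ, (0:ℝ) ≤ m := fun m => Nat.cast_nonneg m
  have main : ∀ m : ℕ, RR (y^2) (2*m) = EE (y^2) y m := by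
    intro m
    induction m with
    | zero => simp [RR_zero, EE]
    | succ m ih =>
      have a1 := hodd m
      have a2 := heven m
      have b1 : (2*(m:ℝ)+2)^2 - y^2 ≠ 0 := by
        have := hm0 m
        have : 0 < (2*(m:ℝ)+2)^2 - y^2 := by nlinarith
        exact this.ne'
      have b2 : (2*(m:ℝ)+1)^2 + y^2 ≠ 0 := by positivity
      rw [EE, ← ih, mul_div_assoc', eq_div_iff (mul_ne_zero b1 b2), ← mul_assoc, a2]
      linear_combination ((2*(m:ℝ)+2)^2 + y^2) * a1
  refine ⟨main m, ?_, ?_⟩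
  · rw [← main m]; exact hodd m
  · rw [← main (m+1)]; exact (heven m).symm

lemma sum_range_two_mul (f : ℕ → ℝ) (n : ℕ) : ∑ k ∈ Finset.range (2*n), f k =
    ∑ m ∈ Finset.range n, (f (2*m) + f (2*m+1)) := by
  induction n with
  | zero => simp
  | succ n ih => rw [show 2*(n+1) = 2*n+1+1 by ring, Finset.sum_range_succ, Finset.sum_range_succ, ih, Finset.sum_range_succ]; ring

lemma gg_hasSum {y : ℝ} (hy0 : 0 < y) (h1 : y ^ 2 ≤ 1/8) :
    HasSum (fun m => gg m * (y^2)^m) (2 * jj (y^2) y) := by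
  have h0 : 0 ≤ y^2 := by positivity
  -- product summability
  have hP : Summable (fun p : ℕ × ℕ => (rr p.1 (p.2+1) + rr p.1 p.2) / ((p.2:ℝ)+1)^3 * (y^2)^p.1) := by
    have hb : Summable (fun p : ℕ × ℕ => (2 * (1/2:ℝ)^p.1) * (1 / ((p.2+1:ℕ):ℝ)^3)) :=
      (summable_geometric_two.mul_left 2).mul_of_nonneg summable_cube (fun _ => by positivity) (fun _ => by positivity)
    refine Summable.of_norm_bounded hb fun p => ?_
    have a1 := rr_term_le h0 h1 (p.2+1) p.1
    have a2 := rr_term_le h0 h1 p.2 p.1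
    have e : (rr p.1 (p.2+1) + rr p.1 p.2) / ((p.2:ℝ)+1)^3 * (y^2)^p.1 =
      (rr p.1 (p.2+1) * (y^2)^p.1 + rr p.1 p.2 * (y^2)^p.1) / ((p.2:ℝ)+1)^3 := by ring
    rw [e, Real.norm_eq_abs, abs_div, abs_of_pos (a := ((p.2:ℝ)+1)^3) (by positivity), mul_one_div]
    push_cast
    gcongr
    refine (abs_add_le _ _).trans ?_
    linarith
  have e1 : ∀ m, ∑' k, (rr m (k+1) + rr m k) / ((k:ℝ)+1)^3 * (y^2)^m = gg m * (y^2)^m := by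
    intro m; rw [tsum_mul_right]; rfl
  have e2 : ∀ k, ∑' m, (rr m (k+1) + rr m k) / ((k:ℝ)+1)^3 * (y^2)^m = (RR (y^2) (k+1) + RR (y^2) k) / ((k:ℝ)+1)^3 := by
    intro k
    unfold RR
    rw [← (rr_summable h0 h1 (k+1)).tsum_add (rr_summable h0 h1 k), ← tsum_div_const]
    refine tsum_congr fun m => by ring
  have s1 : Summable (fun m => gg m * (y^2)^m) := by
    have := hP.prod
    simpa only [e1] using this
  have s2 : Summable (fun k : ℕ => (RR (y^2) (k+1) + RR (y^2) k) / ((k:ℝ)+1)^3) := by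
    have := hP.prod_symm.prod
    simpa only [Prod.fst_swap, Prod.snd_swap, e2] using this
  have e3 : ∑' m, gg m * (y^2)^m = ∑' k : ℕ, (RR (y^2) (k+1) + RR (y^2) k) / ((k:ℝ)+1)^3 := by
    have := hP.tsum_comm (f := fun m k => (rr m (k+1) + rr m k) / ((k:ℝ)+1)^3 * (y^2)^m)
    simp only [e1, e2] at this
    exact this.symm
  have e4 : ∑' k : ℕ, (RR (y^2) (k+1) + RR (y^2) k) / ((k:ℝ)+1)^3 = 2 * jj (y^2) y := by
    have t1 := s2.hasSum.tendsto_sum_nat.comp (tendsto_id.const_mul_atTop' two_pos)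
    have su : Summable (uu (y^2) y) := by
      refine uu_summable_of_bdd (C := 2) (by positivity) fun m => ?_
      rw [← (RR_even h1 m).1]
      exact RR_bound h0 h1 _
    have t2 := su.hasSum.tendsto_sum_nat.const_mul 2
    refine tendsto_nhds_unique t1 (t2.congr fun n => ?_)
    simp only [Function.comp, id]
    rw [sum_range_two_mul, Finset.mul_sum]
    refine Finset.sum_congr rfl fun m _ => ?_
    obtain ⟨b1, b2, b3⟩ := RR_even h1 m
    have c1 : RR (y^2) (2*m+1+1) = EE (y^2) y (m+1) := (RR_even h1 (m+1)).1
    rw [c1, b1]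
    unfold uu
    push_cast
    have d1 : (2*(m:ℝ)+1)^2 + y^2 ≠ 0 := by positivity
    have d2 : (2*(m:ℝ)+2)^2 + y^2 ≠ 0 := by positivity
    have d3 : (2*(m:ℝ)+1) ≠ 0 := by positivity
    have d4 : (2*(m:ℝ)+2) ≠ 0 := by positivity
    have f1 : (RR (y^2) (2*m+1) + EE (y^2) y m) / (2*(m:ℝ)+1)^3 = 2 * (EE (y^2) y m / ((2*(m:ℝ)+1) * ((2*(m:ℝ)+1)^2 + y^2))) := by
      rw [mul_div_assoc', div_eq_div_iff (by positivity) (by positivity)]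
      linear_combination (2*(m:ℝ)+1) * b2
    have f2 : (EE (y^2) y (m+1) + RR (y^2) (2*m+1)) / (2*(m:ℝ)+1+1)^3 = 2 * (EE (y^2) y (m+1) / ((2*(m:ℝ)+2) * ((2*(m:ℝ)+2)^2 + y^2))) := by
      rw [show 2*(m:ℝ)+1+1 = 2*m+2 by ring, mul_div_assoc', div_eq_div_iff (by positivity) (by positivity)]
      linear_combination (2*(m:ℝ)+2) * b3
    rw [f1, f2]
    ring
  rw [← e4, ← e3]
  exact s1.hasSum

/-! ### Part V: special functions and coefficient extraction -/

lemma hs_conv {ι : Type*} {f g : ι → ℝ} {a b : ℝ} (h : HasSum f a) (hf : ∀ i, g i = f i)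
    (hb : b = a) : HasSum g b := by
  subst hb
  exact (funext hf : g = f) ▸ h

lemma geom_swap {u v : ℕ → ℝ} {x : ℝ} (hu : Summable fun k => |u k|) (hv : ∀ k, |v k| ≤ 1)
    (hx : |x| < 1) :
    HasSum (fun m : ℕ => (∑' k, u k * v k ^ m) * x ^ m) (∑' k, u k / (1 - v k * x)) := by
  have hs : Summable (fun p : ℕ × ℕ => u p.1 * (v p.1 * x) ^ p.2) := by
    refine Summable.of_norm_bounded (g := fun p : ℕ × ℕ => |u p.1| * |x| ^ p.2) ?_ ?_
    · exact hu.mul_of_nonneg (summable_geometric_of_lt_one (abs_nonneg _) hx)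
        (fun _ => abs_nonneg _) (fun _ => by positivity)
    · rintro ⟨k, m⟩
      simp only [Real.norm_eq_abs, abs_mul, abs_pow]
      apply mul_le_mul_of_nonneg_left _ (abs_nonneg _)
      apply pow_le_pow_left₀ (by positivity)
      nlinarith [hv k, abs_nonneg x]
  have hvx : ∀ k, |v k * x| < 1 := fun k => by
    rw [abs_mul]
    nlinarith [hv k, abs_nonneg x]
  have e1 : ∑' p : ℕ × ℕ, u p.1 * (v p.1 * x) ^ p.2 = ∑' k, u k / (1 - v k * x) := by
    rw [hs.tsum_prod]
    apply tsum_congr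
    intro k
    simp only
    rw [tsum_mul_left, tsum_geometric_of_abs_lt_one (hvx k)]
    rfl
  have hs2 := (Equiv.prodComm ℕ ℕ).summable_iff.mpr hs
  have h2 := hs2.hasSum
  have e2 : ∑' p : ℕ × ℕ, ((fun p : ℕ × ℕ => u p.1 * (v p.1 * x) ^ p.2) ∘ (Equiv.prodComm ℕ ℕ)) p
      = ∑' k, u k / (1 - v k * x) := by
    rw [← e1]
    exact (Equiv.prodComm ℕ ℕ).tsum_eq (fun p : ℕ × ℕ => u p.1 * (v p.1 * x) ^ p.2)
  rw [e2] at h2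
  have h3 := h2.prod_fiberwise (g := fun m => (∑' k, u k * v k ^ m) * x ^ m) ?_
  · exact h3
  · intro m
    have := (hs2.prod_factor m).hasSum
    refine hs_conv this (fun _ => rfl) ?_
    rw [← tsum_mul_right]
    apply tsum_congr
    intro k
    simp [mul_pow, mul_assoc]

lemma ps_zero {a : ℕ → ℝ} {ε : ℝ} (hε : 0 < ε)
    (h : ∀ x, 0 < x → x < ε → HasSum (fun m => a m * x ^ m) 0) : a 0 = 0 := by
  have h0 := h (ε / 2) (by linarith) (by linarith)
  have ht := tendsto_tsum_of_dominated_convergence (𝓕 := 𝓝[>] (0:ℝ))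
    (f := fun x m => a m * x ^ m) (g := fun m => a m * 0 ^ m)
    (bound := fun m => |a m * (ε / 2) ^ m|) h0.summable.abs ?_ ?_
  · have h2 : Tendsto (fun x : ℝ => ∑' m, a m * x ^ m) (𝓝[>] (0:ℝ)) (𝓝 0) := by
      apply tendsto_const_nhds.congr'
      have : Set.Ioo 0 ε ∈ 𝓝[>] (0:ℝ) := Ioo_mem_nhdsGT hε
      filter_upwards [this] with x hx
      exact ((h x hx.1 hx.2).tsum_eq).symm
    have h3 := tendsto_nhds_unique ht h2
    rw [tsum_eq_single 0] at h3
    · simpa using h3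
    · intro m hm
      simp [hm]
  · intro m
    apply tendsto_nhdsWithin_of_tendsto_nhds
    have : Continuous (fun x : ℝ => a m * x ^ m) := by fun_prop
    exact this.tendsto 0
  · have : Set.Ioo 0 (ε / 2) ∈ 𝓝[>] (0:ℝ) := Ioo_mem_nhdsGT (by linarith)
    filter_upwards [this] with x hx
    intro m
    rw [Real.norm_eq_abs, abs_mul, abs_mul, abs_pow, abs_pow, abs_of_pos hx.1,
      abs_of_pos (by linarith : 0 < ε / 2)]
    have := hx.2.le
    have := hx.1.le
    gcongr

lemma ps_unique {ε : ℝ} (hε : 0 < ε) (m : ℕ) : ∀ {a : ℕ → ℝ},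
    (∀ x, 0 < x → x < ε → HasSum (fun m => a m * x ^ m) 0) → a m = 0 := by
  induction m with
  | zero => intro a h; exact ps_zero hε h
  | succ m ih =>
    intro a h
    apply ih (a := fun m => a (m + 1))
    intro x hx hx2
    have h1 := h x hx hx2
    have h0 := ps_zero hε h
    have h2 := (hasSum_nat_add_iff' 1).mpr h1
    simp only [Finset.range_one, Finset.sum_singleton, h0, zero_mul, sub_zero] at h2
    have h3 := h2.mul_left (x⁻¹)
    rw [mul_zero] at h3
    refine hs_conv h3 (fun m => ?_) rfl
    rw [pow_succ]
    field_simp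

lemma hasSum_even {s : ℕ → ℝ} {x S : ℝ} (h : HasSum (fun c => s c * (x ^ 2) ^ c) S) :
    HasSum (fun m : ℕ => (if m % 2 = 0 then s (m / 2) else 0) * x ^ m) S := by
  have hi : Function.Injective (fun c : ℕ => 2 * c) := fun a b h => by simpa using h
  rw [← hi.hasSum_iff]
  · refine hs_conv h (fun c => ?_) rfl
    simp [pow_mul]
  · intro m hm
    have : m % 2 ≠ 0 := fun h => hm ⟨m / 2, by simp only; omega⟩
    simp [this]

lemma hasSum_odd' {s : ℕ → ℝ} {x S : ℝ} (h : HasSum (fun c => s c * (x ^ 2) ^ c) S) :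
    HasSum (fun m : ℕ => (if m % 2 = 1 then s (m / 2) else 0) * x ^ m) (x * S) := by
  have hi : Function.Injective (fun c : ℕ => 2 * c + 1) := fun a b h => by simpa using h
  rw [← hi.hasSum_iff]
  · refine hs_conv (h.mul_left x) (fun c => ?_) rfl
    have : (2 * c + 1) / 2 = c := by omega
    have h2 : (2 * c + 1) % 2 = 1 := by omega
    simp only [Function.comp, this, h2, if_true]
    ring
  · intro m hm
    have : m % 2 ≠ 1 := fun h => hm ⟨m / 2, by simp only; omega⟩
    simp [this]

/-- real zeta values -/
noncomputable def zr (s : ℕ) : ℝ := ∑' k : ℕ, 1 / ((k : ℝ) + 1) ^ s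

lemma zr_summable {s : ℕ} (hs : 2 ≤ s) : Summable (fun k : ℕ => 1 / ((k : ℝ) + 1) ^ s) := by
  have := (summable_nat_add_iff 1).mpr (Real.summable_one_div_nat_pow.mpr (by omega : 1 < s))
  simpa using this

lemma zr_cast {s : ℕ} (hs : 2 ≤ s) : riemannZeta (s : ℂ) = ((zr s : ℝ) : ℂ) := by
  rw [zeta_nat_eq_tsum_of_gt_one (by omega)]
  have h1 : Summable (fun n : ℕ => 1 / (n : ℂ) ^ s) := by
    have := Real.summable_one_div_nat_pow.mpr (by omega : 1 < s)
    have := Complex.ofRealCLM.summable this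
    simpa using this
  rw [h1.tsum_eq_zero_add, zr, Complex.ofReal_tsum]
  have : s ≠ 0 := by omega
  simp [this]

/-- zeta at even arguments with value `-1/2` at zero -/
noncomputable def ze (b : ℕ) : ℝ := if b = 0 then -1 / 2 else zr (2 * b)

lemma ze_cast (b : ℕ) : riemannZeta (2 * (b : ℂ)) = ((ze b : ℝ) : ℂ) := by
  unfold ze
  split_ifs with h
  · subst h
    simp [riemannZeta_zero]
  · rw [← zr_cast (by omega)]
    push_cast
    rfl

lemma abs_inv_pow_le (k s : ℕ) : |1 / ((k : ℝ) + 1) ^ s| ≤ 1 := by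
  rw [abs_of_nonneg (by positivity)]
  have : (1:ℝ) ≤ ((k : ℝ) + 1) ^ s := one_le_pow₀ (by linarith [(Nat.cast_nonneg k : (0:ℝ) ≤ k)])
  rw [div_le_one (by positivity)]
  exact this

lemma ze_hasSum {x : ℝ} (hx : |x| < 1) :
    HasSum (fun b => ze b * x ^ b) (-1 / 2 + x * ∑' k : ℕ, 1 / (((k : ℝ) + 1) ^ 2 - x)) := by
  have h := geom_swap (u := fun k => 1 / ((k : ℝ) + 1) ^ 2) (v := fun k => 1 / ((k : ℝ) + 1) ^ 2)
    (x := x) (zr_summable (le_refl 2)).abs (fun k => abs_inv_pow_le k 2) hx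
  rw [← hasSum_nat_add_iff' 1]
  refine hs_conv (h.mul_left x) (fun b => ?_) ?_
  · have : ze (b + 1) = ∑' k : ℕ, 1 / ((k : ℝ) + 1) ^ 2 * (1 / ((k : ℝ) + 1) ^ 2) ^ b := by
      rw [ze, if_neg (by omega), zr]
      apply tsum_congr
      intro k
      rw [one_div_pow, ← pow_mul]
      rw [show 2 * (b + 1) = 2 + 2 * b by ring, pow_add, ← one_div_mul_one_div]
    rw [this]; ring
  · simp only [Finset.range_one, Finset.sum_singleton, pow_zero, mul_one]
    rw [show ze 0 = -1 / 2 by simp [ze]]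
    rw [add_sub_cancel_left]
    congr 1
    apply tsum_congr
    intro k
    have h1 : (k:ℝ) + 1 ≠ 0 := by positivity
    rw [div_div]
    congr 1
    field_simp


lemma cot_formula {x : ℂ} (hx : x ∈ Complex.integerComplement) :
    -1 / 2 + x ^ 2 * ∑' k : ℕ, 1 / (((k : ℂ) + 1) ^ 2 - x ^ 2) =
      -(Real.pi * x / 2) * (Complex.cos (Real.pi * x) / Complex.sin (Real.pi * x)) := by
  have h := cot_series_rep' hx
  have hx0 : x ≠ 0 := Complex.integerComplement.ne_zero hx
  have h2 : ∑' n : ℕ, (1 / (x - (n + 1)) + 1 / (x + (n + 1)))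
      = -(2 * x) * ∑' k : ℕ, 1 / (((k : ℂ) + 1) ^ 2 - x ^ 2) := by
    rw [← tsum_mul_left]
    apply tsum_congr
    intro k
    have h1 : x - (k + 1) ≠ 0 := by
      have := Complex.integerComplement_add_ne_zero hx (-(k + 1 : ℤ))
      push_cast at this
      rwa [sub_eq_add_neg]
    have h3 : x + (k + 1) ≠ 0 := by
      have := Complex.integerComplement_add_ne_zero hx (k + 1 : ℤ)
      push_cast at this
      exact this
    have h4 : ((k : ℂ) + 1) ^ 2 - x ^ 2 ≠ 0 := by
      have : ((k : ℂ) + 1) ^ 2 - x ^ 2 = -((x - (k + 1)) * (x + (k + 1))) := by ring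
      rw [this]
      exact neg_ne_zero.mpr (mul_ne_zero h1 h3)
    field_simp
    ring
  rw [h2] at h
  rw [Complex.cot_eq_cos_div_sin] at h
  generalize Complex.cos (Real.pi * x) / Complex.sin (Real.pi * x) = c at *
  generalize ∑' k : ℕ, 1 / (((k : ℂ) + 1) ^ 2 - x ^ 2) = t at *
  have : x * (Real.pi * c - 1 / x) = x * (-(2 * x) * t) := by rw [h]
  have h5 : x * (Real.pi * c - 1 / x) = x * Real.pi * c - 1 := by
    field_simp
  rw [h5] at this
  linear_combination (1 / 2) * this

lemma cot_real {z : ℝ} (h0 : 0 < z) (h1 : z < 1) :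
    -1 / 2 + z ^ 2 * ∑' k : ℕ, 1 / (((k : ℝ) + 1) ^ 2 - z ^ 2) =
      -(Real.pi * z / 2) * (Real.cos (Real.pi * z) / Real.sin (Real.pi * z)) := by
  have hx : (z : ℂ) ∈ Complex.integerComplement := by
    rw [Complex.mem_integerComplement_iff]
    rintro ⟨n, hn⟩
    have : (n : ℝ) = z := by exact_mod_cast hn
    rw [← this] at h0 h1
    have a : 0 < n := by exact_mod_cast h0
    have b : n < 1 := by exact_mod_cast h1
    omega
  have h := cot_formula hx
  apply Complex.ofReal_injective
  push_cast
  exact h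

lemma coth_real {z : ℝ} (h0 : 0 < z) :
    -1 / 2 + -z ^ 2 * ∑' k : ℕ, 1 / (((k : ℝ) + 1) ^ 2 - -z ^ 2) =
      -(Real.pi * z / 2) * (Real.cosh (Real.pi * z) / Real.sinh (Real.pi * z)) := by
  have hx : (z : ℂ) * Complex.I ∈ Complex.integerComplement := by
    rw [Complex.mem_integerComplement_iff]
    rintro ⟨n, hn⟩
    have := congrArg Complex.im hn
    simp at this
    linarith
  have h := cot_formula hx
  apply Complex.ofReal_injective
  push_cast
  rw [← mul_assoc, Complex.cos_mul_I, Complex.sin_mul_I, mul_pow, Complex.I_sq] at h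
  simp only [mul_neg, mul_one] at h
  rw [h]
  have hs : Complex.sinh (Real.pi * z) ≠ 0 := by
    have : Real.sinh (Real.pi * z) ≠ 0 := by
      have := Real.sinh_pos_iff.mpr (mul_pos Real.pi_pos h0)
      exact this.ne'
    exact_mod_cast this
  field_simp

/-- partial Euler products -/
noncomputable def pe (t : ℝ) (n : ℕ) : ℝ := ∏ j ∈ Finset.range n, (1 - t / ((j : ℝ) + 1) ^ 2)

lemma pe_lim {z : ℝ} (h0 : 0 < z) :
    Tendsto (pe (z ^ 2)) atTop (𝓝 (Real.sin (Real.pi * z) / (Real.pi * z))) := by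
  have h := (Real.tendsto_euler_sin_prod z).div_const (Real.pi * z)
  have : Real.pi * z ≠ 0 := (mul_pos Real.pi_pos h0).ne'
  refine h.congr (fun n => ?_)
  rw [mul_div_cancel_left₀ _ this]
  rfl

lemma pe_lim_neg {z : ℝ} (h0 : 0 < z) :
    Tendsto (pe (-z ^ 2)) atTop (𝓝 (Real.sinh (Real.pi * z) / (Real.pi * z))) := by
  have h := (Complex.tendsto_euler_sin_prod (z * Complex.I)).div_const
    (Real.pi * (z * Complex.I))
  have hne : Real.pi * z ≠ 0 := (mul_pos Real.pi_pos h0).ne'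
  have hne' : (Real.pi : ℂ) * z ≠ 0 := by exact_mod_cast hne
  have hne2 : (Real.pi : ℂ) * (z * Complex.I) ≠ 0 := by
    rw [← mul_assoc]
    exact mul_ne_zero hne' Complex.I_ne_zero
  rw [← mul_assoc, Complex.sin_mul_I, mul_div_mul_right _ _ Complex.I_ne_zero] at h
  have h2 := (Complex.continuous_re.tendsto _).comp h
  have e : (Complex.sinh (Real.pi * z) / (Real.pi * z)).re
      = Real.sinh (Real.pi * z) / (Real.pi * z) := by
    rw [← Complex.ofReal_re (Real.sinh (Real.pi * z) / (Real.pi * z))]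
    push_cast
    rfl
  rw [e] at h2
  refine h2.congr (fun n => ?_)
  rw [← mul_assoc] at hne2
  simp only [Function.comp]
  rw [mul_div_cancel_left₀ _ hne2, ← Complex.ofReal_re (pe (-z ^ 2) n), pe]
  congr 1
  push_cast
  apply Finset.prod_congr rfl
  intro j _
  rw [mul_pow, Complex.I_sq]
  ring

lemma pe_ne {t : ℝ} (ht : t < 1) (n : ℕ) : pe t n ≠ 0 := by
  apply Finset.prod_ne_zero_iff.mpr
  intro j _
  have : (1:ℝ) ≤ ((j:ℝ) + 1) ^ 2 := one_le_pow₀ (by linarith [(Nat.cast_nonneg j : (0:ℝ) ≤ j)])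
  have h2 : t / ((j:ℝ) + 1) ^ 2 < 1 := by
    rw [div_lt_one (by linarith)]
    linarith
  linarith

lemma EE_pe {y : ℝ} (hy : 0 < y) (hy1 : y < 1) (n : ℕ) :
    EE (y ^ 2) y n = pe (-y ^ 2 / 4) n ^ 2 * pe (y ^ 2) (2 * n) /
      (pe (y ^ 2 / 4) n ^ 2 * pe (-y ^ 2) (2 * n)) := by
  have hy2 : y ^ 2 < 1 := by nlinarith
  have hyp : 0 < y ^ 2 := by positivity
  rw [eq_div_iff (mul_ne_zero (pow_ne_zero 2 (pe_ne (by linarith) n)) (pe_ne (by linarith) (2 * n)))]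
  induction n with
  | zero => simp [EE, pe]
  | succ n ih =>
    have e1 : ∀ t m, pe t (m + 1) = pe t m * (1 - t / ((m:ℝ) + 1) ^ 2) := fun t m =>
      Finset.prod_range_succ _ _
    rw [show 2 * (n + 1) = 2 * n + 1 + 1 by ring]
    simp only [e1]
    have hE : EE (y ^ 2) y (n + 1) = EE (y ^ 2) y n * (((2*n+2)^2+y^2)*((2*n+1)^2-y^2)/(((2*n+2)^2-y^2)*((2*n+1)^2+y^2))) := by
      rfl
    rw [hE]
    push_cast
    have hn : (0:ℝ) ≤ n := Nat.cast_nonneg n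
    have n1 : ((2*(n:ℝ)+2)^2-y^2) ≠ 0 := by nlinarith
    have n2 : ((2*(n:ℝ)+1)^2+y^2) ≠ 0 := by positivity
    generalize pe (-y ^ 2 / 4) n = a at *
    generalize pe (y ^ 2) (2 * n) = b at *
    generalize pe (y ^ 2 / 4) n = c at *
    generalize pe (-y ^ 2) (2 * n) = d at *
    generalize EE (y ^ 2) y n = E at *
    have n3 : (n:ℝ) + 1 ≠ 0 := by positivity
    have n4 : 2 * (n:ℝ) + 1 ≠ 0 := by positivity
    have key : (((2*n+2)^2+y^2)*((2*n+1)^2-y^2)/(((2*n+2)^2-y^2)*((2*n+1)^2+y^2))) *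
        ((1 - y^2/4/((n:ℝ)+1)^2)^2 * ((1 - -y^2/(2*(n:ℝ)+1)^2) * (1 - -y^2/(2*(n:ℝ)+1+1)^2)))
        = (1 - -y^2/4/((n:ℝ)+1)^2)^2 * ((1 - y^2/(2*(n:ℝ)+1)^2) * (1 - y^2/(2*(n:ℝ)+1+1)^2)) := by
      have f1 : 1 - y^2/4/((n:ℝ)+1)^2 = ((2*n+2)^2-y^2) / (2*n+2)^2 := by field_simp; ring
      have f2 : 1 - -y^2/4/((n:ℝ)+1)^2 = ((2*n+2)^2+y^2) / (2*n+2)^2 := by field_simp; ring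
      have f3 : 1 - -y^2/(2*(n:ℝ)+1)^2 = ((2*n+1)^2+y^2) / (2*n+1)^2 := by field_simp; ring
      have f4 : 1 - y^2/(2*(n:ℝ)+1)^2 = ((2*n+1)^2-y^2) / (2*n+1)^2 := by field_simp
      have f5 : 1 - -y^2/(2*(n:ℝ)+1+1)^2 = ((2*n+2)^2+y^2) / (2*n+2)^2 := by
        rw [show 2*(n:ℝ)+1+1 = 2*n+2 by ring]; field_simp; ring
      have f6 : 1 - y^2/(2*(n:ℝ)+1+1)^2 = ((2*n+2)^2-y^2) / (2*n+2)^2 := by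
        rw [show 2*(n:ℝ)+1+1 = 2*n+2 by ring]; field_simp
      rw [f1, f2, f3, f4, f5, f6]
      have n5 : (2*(n:ℝ)+2) ≠ 0 := by positivity
      generalize ((2*(n:ℝ)+2)^2-y^2) = q at *
      generalize ((2*(n:ℝ)+1)^2+y^2) = r at *
      generalize ((2*(n:ℝ)+2)^2+y^2) = q' at *
      generalize ((2*(n:ℝ)+1)^2-y^2) = r' at *
      field_simp
    generalize (((2*n+2)^2+y^2)*((2*n+1)^2-y^2)/(((2*n+2)^2-y^2)*((2*n+1)^2+y^2))) = K at *
    generalize (1 - y^2/4/((n:ℝ)+1)^2) = A1 at *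
    generalize (1 - -y^2/4/((n:ℝ)+1)^2) = A2 at *
    generalize (1 - -y^2/(2*(n:ℝ)+1)^2) = A3 at *
    generalize (1 - y^2/(2*(n:ℝ)+1)^2) = A4 at *
    generalize (1 - -y^2/(2*(n:ℝ)+1+1)^2) = A5 at *
    generalize (1 - y^2/(2*(n:ℝ)+1+1)^2) = A6 at *
    linear_combination (K * (A1^2*(A3*A5))) * ih + a^2*b*key

lemma EE_lim {y : ℝ} (hy : 0 < y) (hy1 : y < 1) :
    Tendsto (EE (y ^ 2) y) atTop (𝓝 (Real.sinh (Real.pi * (y / 2)) / Real.cosh (Real.pi * (y / 2)) *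
      (Real.cos (Real.pi * (y / 2)) / Real.sin (Real.pi * (y / 2))))) := by
  have h1 := pe_lim hy
  have h2 := pe_lim_neg hy
  have h3 := pe_lim (half_pos hy)
  have h4 := pe_lim_neg (half_pos hy)
  rw [show (y / 2) ^ 2 = y ^ 2 / 4 by ring] at h3
  rw [show -(y / 2) ^ 2 = -y ^ 2 / 4 by ring] at h4
  have ht : Tendsto (fun n : ℕ => 2 * n) atTop atTop :=
    tendsto_id.const_mul_atTop' (by norm_num)
  have hw : 0 < Real.pi * (y / 2) := mul_pos Real.pi_pos (half_pos hy)
  have hw2 : Real.pi * (y / 2) < Real.pi := by nlinarith [Real.pi_pos]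
  have e : Real.pi * y = 2 * (Real.pi * (y / 2)) := by ring
  rw [e, Real.sin_two_mul] at h1
  rw [e, Real.sinh_two_mul] at h2
  have hs := Real.sin_pos_of_pos_of_lt_pi hw hw2
  have hsh := Real.sinh_pos_iff.mpr hw
  have hc := Real.cosh_pos (Real.pi * (y / 2))
  generalize Real.pi * (y / 2) = w at *
  have h := ((h4.pow 2).mul (h1.comp ht)).div ((h3.pow 2).mul (h2.comp ht)) (by positivity)
  have h' : Tendsto (EE (y ^ 2) y) atTop _ := h.congr (fun n => (EE_pe hy hy1 n).symm)
  convert h' using 2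
  field_simp


lemma geom_summable {u v : ℕ → ℝ} {x : ℝ} (hu : Summable fun k => |u k|) (hv : ∀ k, |v k| ≤ 1)
    (hx : |x| < 1) : Summable (fun k => u k / (1 - v k * x)) := by
  refine Summable.of_norm_bounded (g := fun k => |u k| * (1 / (1 - |x|))) (hu.mul_right _) ?_
  intro k
  have h1 : 1 - |x| ≤ 1 - v k * x := by
    have : v k * x ≤ |x| := by
      refine (le_abs_self _).trans ?_
      rw [abs_mul]
      nlinarith [hv k, abs_nonneg x]
    linarith
  have h0 : 0 < 1 - |x| := by linarith
  rw [Real.norm_eq_abs, abs_div, abs_of_pos (lt_of_lt_of_le h0 h1), div_eq_mul_one_div]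
  gcongr

/-- generating value -/
noncomputable def JJ (p q : ℕ) (x : ℝ) : ℝ :=
  ∑' k : ℕ, 1 / ((k : ℝ) + 1) ^ p / (1 - 1 / ((k : ℝ) + 1) ^ q * x)

/-- odd generating value -/
noncomputable def JO (p q : ℕ) (x : ℝ) : ℝ :=
  ∑' k : ℕ, 1 / (2 * (k : ℝ) + 1) ^ p / (1 - 1 / (2 * (k : ℝ) + 1) ^ q * x)

/-- odd zeta sums -/
noncomputable def zo (s : ℕ) : ℝ := ∑' k : ℕ, 1 / (2 * (k : ℝ) + 1) ^ s

lemma zo_summable {s : ℕ} (hs : 2 ≤ s) : Summable (fun k : ℕ => 1 / (2 * (k : ℝ) + 1) ^ s) := by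
  have h := (zr_summable hs).comp_injective (i := fun k : ℕ => 2 * k)
    (fun a b h => by simpa using h)
  refine h.congr (fun k => ?_)
  simp

lemma zo_add {s : ℕ} (hs : 2 ≤ s) : zo s + zr s / 2 ^ s = zr s := by
  have h2 : Summable (fun k : ℕ => (fun j : ℕ => 1 / ((j : ℝ) + 1) ^ s) (2 * k + 1)) := by
    refine ((zr_summable hs).div_const (2 ^ s)).congr (fun k => ?_)
    push_cast
    rw [show 2 * (k:ℝ) + 1 + 1 = (k + 1) * 2 by ring, mul_pow, div_div]
  have h1 : Summable (fun k : ℕ => (fun j : ℕ => 1 / ((j : ℝ) + 1) ^ s) (2 * k)) := by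
    refine (zo_summable hs).congr (fun k => ?_)
    push_cast
    rfl
  have h := tsum_even_add_odd (f := fun j : ℕ => 1 / ((j : ℝ) + 1) ^ s) h1 h2
  have e1 : zo s = ∑' k : ℕ, (fun j : ℕ => 1 / ((j : ℝ) + 1) ^ s) (2 * k) := by
    apply tsum_congr
    intro k
    push_cast
    rfl
  have e2 : zr s / 2 ^ s = ∑' k : ℕ, (fun j : ℕ => 1 / ((j : ℝ) + 1) ^ s) (2 * k + 1) := by
    rw [zr, ← tsum_div_const]
    apply tsum_congr
    intro k
    push_cast
    rw [show 2 * (k:ℝ) + 1 + 1 = (k + 1) * 2 by ring, mul_pow, div_div]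
  rw [e1, e2, h]
  rfl

lemma JJ_summable {p : ℕ} (hp : 2 ≤ p) (q : ℕ) {x : ℝ} (hx : |x| < 1) :
    Summable (fun k : ℕ => 1 / ((k : ℝ) + 1) ^ p / (1 - 1 / ((k : ℝ) + 1) ^ q * x)) :=
  geom_summable (zr_summable hp).abs (fun k => abs_inv_pow_le k q) hx

lemma JJ_hasSum {p : ℕ} (hp : 2 ≤ p) (q : ℕ) {x : ℝ} (hx : |x| < 1) :
    HasSum (fun m => zr (p + q * m) * x ^ m) (JJ p q x) := by
  refine hs_conv (geom_swap (zr_summable hp).abs (fun k => abs_inv_pow_le k q) hx) (fun m => ?_) rfl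
  congr 1
  apply tsum_congr
  intro k
  rw [one_div_pow, ← pow_mul, pow_add, one_div_mul_one_div]

lemma abs_inv_odd_le (q k : ℕ) : |1 / (2 * (k : ℝ) + 1) ^ q| ≤ 1 := by
  have := abs_inv_pow_le (2 * k) q
  push_cast at this
  exact this

lemma JO_summable {p : ℕ} (hp : 2 ≤ p) (q : ℕ) {x : ℝ} (hx : |x| < 1) :
    Summable (fun k : ℕ => 1 / (2 * (k : ℝ) + 1) ^ p / (1 - 1 / (2 * (k : ℝ) + 1) ^ q * x)) :=
  geom_summable (zo_summable hp).abs (abs_inv_odd_le q) hx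

lemma JO_hasSum {p : ℕ} (hp : 2 ≤ p) (q : ℕ) {x : ℝ} (hx : |x| < 1) :
    HasSum (fun m => zo (p + q * m) * x ^ m) (JO p q x) := by
  refine hs_conv (geom_swap (zo_summable hp).abs (abs_inv_odd_le q) hx) (fun m => ?_) rfl
  congr 1
  apply tsum_congr
  intro k
  rw [one_div_pow, ← pow_mul, pow_add, one_div_mul_one_div]

lemma jj_formula {y : ℝ} (hy : 0 < y) (hy1 : y < 1) {R : ℝ}
    (ht : Tendsto (EE (y ^ 2) y) atTop (𝓝 R)) :
    2 * jj (y ^ 2) y = 4 * JO 3 2 (-y ^ 2) - 1 / 2 * JJ 3 2 (y ^ 2 / 4)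
      - y ^ 2 * (1 / 2 * JJ 5 4 (-(y ^ 2) ^ 2 / 4)) - R * JJ 3 4 (-(y ^ 2) ^ 2 / 4) := by
  have hy2 : y ^ 2 < 1 := by nlinarith
  have hyp : 0 < y ^ 2 := by positivity
  have a1 : |-y ^ 2| < 1 := by rw [abs_lt]; constructor <;> linarith
  have a2 : |y ^ 2 / 4| < 1 := by rw [abs_lt]; constructor <;> linarith
  have a3 : |-(y ^ 2) ^ 2 / 4| < 1 := by rw [abs_lt]; constructor <;> nlinarith
  have s1 := (JO_summable (p := 3) (by norm_num) 2 a1).hasSum.mul_left 2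
  have s2 := (JJ_summable (p := 3) (by norm_num) 2 a2).hasSum.mul_left (1 / 4)
  have s3 := (JJ_summable (p := 5) (by norm_num) 4 a3).hasSum.mul_left (y ^ 2 / 4)
  have s4 := (JJ_summable (p := 3) (by norm_num) 4 a3).hasSum.mul_left (R / 2)
  have h := (((s1.sub s2).sub s3).sub s4).tendsto_sum_nat
  have h2 := jj_eval hy hy1 ht
  have h3 := tendsto_nhds_unique (h2.congr (fun n => Finset.sum_congr rfl (fun k _ => ?_))) h
  · rw [h3]
    unfold JJ JO
    ring
  · have hk : (0:ℝ) ≤ k := Nat.cast_nonneg k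
    have q1 : (0:ℝ) < k + 1 := by positivity
    have q2 : (0:ℝ) < 2 * k + 1 := by positivity
    have q3 : 0 < 4 * ((k:ℝ) + 1) ^ 2 - y ^ 2 := by nlinarith
    have e1 : 2 * (1 / (2 * (k : ℝ) + 1) ^ 3 / (1 - 1 / (2 * (k : ℝ) + 1) ^ 2 * -y ^ 2))
        = 2/((2*(k:ℝ)+1)*((2*(k:ℝ)+1)^2+y^2)) := by
      have : 1 - 1 / (2 * (k : ℝ) + 1) ^ 2 * -y ^ 2
        = ((2*(k:ℝ)+1)^2+y^2) / (2 * (k : ℝ) + 1) ^ 2 := by field_simp; ring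
      rw [this]
      have : (2*(k:ℝ)+1)^2+y^2 ≠ 0 := by positivity
      generalize (2*(k:ℝ)+1)^2+y^2 = A at *
      field_simp
    have e2 : 1 / 4 * (1 / ((k : ℝ) + 1) ^ 3 / (1 - 1 / ((k : ℝ) + 1) ^ 2 * (y ^ 2 / 4)))
        = 1/((k+1:ℝ)*(4*(k+1:ℝ)^2-y^2)) := by
      have : 1 - 1 / ((k : ℝ) + 1) ^ 2 * (y ^ 2 / 4)
        = (4*(k+1:ℝ)^2-y^2) / (4 * ((k : ℝ) + 1) ^ 2) := by field_simp
      rw [this]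
      have := q3.ne'
      generalize 4*(k+1:ℝ)^2-y^2 = A at *
      field_simp
    have q4 : 4*(k+1:ℝ)^4+(y^2)^2 ≠ 0 := by positivity
    have e0 : 1 - 1 / ((k : ℝ) + 1) ^ 4 * (-(y ^ 2) ^ 2 / 4)
        = (4*(k+1:ℝ)^4+(y^2)^2) / (4 * ((k : ℝ) + 1) ^ 4) := by field_simp; ring
    have e3 : y ^ 2 / 4 * (1 / ((k : ℝ) + 1) ^ 5 / (1 - 1 / ((k : ℝ) + 1) ^ 4 * (-(y ^ 2) ^ 2 / 4)))
        = y^2/((k+1:ℝ)*(4*(k+1:ℝ)^4+(y^2)^2)) := by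
      rw [e0]
      generalize 4*(k+1:ℝ)^4+(y^2)^2 = A at *
      field_simp
    have e4 : R / 2 * (1 / ((k : ℝ) + 1) ^ 3 / (1 - 1 / ((k : ℝ) + 1) ^ 4 * (-(y ^ 2) ^ 2 / 4)))
        = R*(2*(k+1:ℝ)/(4*(k+1:ℝ)^4+(y^2)^2)) := by
      rw [e0]
      generalize 4*(k+1:ℝ)^4+(y^2)^2 = A at *
      field_simp
      ring
    rw [e1, e2, e3, e4]
    ring

/-- rational part coefficients -/
noncomputable def ec (m : ℕ) : ℝ :=
  4 * (-1) ^ m * zo (3 + 2 * m) - 1 / 2 * (1 / 4) ^ m * zr (3 + 2 * m)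
    - (if m % 2 = 1 then (1 / 2) * (-1 / 4) ^ (m / 2) * zr (5 + 4 * (m / 2)) else 0)

lemma ec_hasSum {x : ℝ} (h0 : 0 < x) (h1 : x < 1) :
    HasSum (fun m => ec m * x ^ m) (4 * JO 3 2 (-x) - 1 / 2 * JJ 3 2 (x / 4)
      - x * (1 / 2 * JJ 5 4 (-x ^ 2 / 4))) := by
  have a1 : |-x| < 1 := by rw [abs_lt]; constructor <;> linarith
  have a2 : |x / 4| < 1 := by rw [abs_lt]; constructor <;> linarith
  have a3 : |-x ^ 2 / 4| < 1 := by rw [abs_lt]; constructor <;> nlinarith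
  have s1 := (JO_hasSum (p := 3) (by norm_num) 2 a1).mul_left 4
  have s2 := (JJ_hasSum (p := 3) (by norm_num) 2 a2).mul_left (1 / 2)
  have s3 := (JJ_hasSum (p := 5) (by norm_num) 4 a3).mul_left (1 / 2)
  have s4 : HasSum (fun c => ((1 / 2) * (-1 / 4) ^ c * zr (5 + 4 * c)) * (x ^ 2) ^ c)
      (1 / 2 * JJ 5 4 (-x ^ 2 / 4)) := by
    refine hs_conv s3 (fun c => ?_) rfl
    rw [show -x ^ 2 / 4 = (-1 / 4) * x ^ 2 by ring, mul_pow]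
    ring
  refine hs_conv ((s1.sub s2).sub (hasSum_odd' s4)) (fun m => ?_) rfl
  rw [show -x = (-1) * x by ring, show x / 4 = (1 / 4) * x by ring, mul_pow, mul_pow, ec]
  ring

lemma ec_odd (n : ℕ) : ec (2 * n + 1) = -(4 + 1 / 2 * (-1 / 4) ^ n) * zr (4 * n + 5) := by
  unfold ec
  have h1 : (2 * n + 1) / 2 = n := by omega
  have h2 : (2 * n + 1) % 2 = 1 := by omega
  rw [h1, h2, if_pos rfl, show 3 + 2 * (2 * n + 1) = 4 * n + 5 by ring,
    show 5 + 4 * n = 4 * n + 5 by ring]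
  have h := zo_add (s := 4 * n + 5) (by omega)
  have h3 : (-1 : ℝ) ^ (2 * n + 1) = -1 := Odd.neg_one_pow ⟨n, rfl⟩
  have h4 : (1 / 2 : ℝ) * (1 / 4) ^ (2 * n + 1) = 4 / 2 ^ (4 * n + 5) := by
    rw [show (1 / 4 : ℝ) = (1 / 2) ^ 2 by norm_num, ← pow_mul,
      show 2 * (2 * n + 1) = 4 * n + 2 by ring, one_div_pow, pow_add, pow_add]
    field_simp
    norm_num
  rw [h3, h4]
  linear_combination (-4) * h

/-- coefficients -/
noncomputable def ac (a : ℕ) : ℝ := (-1) ^ a * (1 - 4 ^ a) / 4 ^ a * ze a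
/-- coefficients -/
noncomputable def bc (b : ℕ) : ℝ := 1 / 4 ^ b * ze b
/-- coefficients -/
noncomputable def sc (c : ℕ) : ℝ := (-1) ^ c / 4 ^ c * zr (3 + 4 * c)

lemma ac_hasSum {y : ℝ} (hy : 0 < y) (hy1 : y < 1) :
    HasSum (fun a => ac a * (y ^ 2) ^ a) (Real.pi * y / 4 *
      (Real.sinh (Real.pi * (y / 2)) / Real.cosh (Real.pi * (y / 2)))) := by
  have hy2 : y ^ 2 < 1 := by nlinarith
  have hyp : 0 < y ^ 2 := by positivity
  have a1 : |-y ^ 2| < 1 := by rw [abs_lt]; constructor <;> linarith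
  have a2 : |-(y / 2) ^ 2| < 1 := by rw [abs_lt]; constructor <;> nlinarith
  have h1 := ze_hasSum a1
  have h2 := ze_hasSum a2
  rw [coth_real hy] at h1
  rw [coth_real (half_pos hy)] at h2
  refine hs_conv (h2.sub h1) (fun a => ?_) ?_
  · rw [ac, show -(y / 2) ^ 2 = (-1) * (1 / 4) * y ^ 2 by ring, show -y ^ 2 = (-1) * y ^ 2 by ring,
      mul_pow, mul_pow, mul_pow, one_div_pow]
    field_simp
  · have hw : 0 < Real.pi * (y / 2) := mul_pos Real.pi_pos (half_pos hy)
    have hsh := Real.sinh_pos_iff.mpr hw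
    have hc := Real.cosh_pos (Real.pi * (y / 2))
    have hcs := Real.cosh_sq (Real.pi * (y / 2))
    rw [show Real.pi * y = 2 * (Real.pi * (y / 2)) by ring, Real.sinh_two_mul, Real.cosh_two_mul]
    generalize Real.pi * (y / 2) = w at *
    generalize Real.sinh w = s at *
    generalize Real.cosh w = c at *
    field_simp
    linear_combination 0 * hcs

lemma bc_hasSum {y : ℝ} (hy : 0 < y) (hy1 : y < 1) :
    HasSum (fun b => bc b * (y ^ 2) ^ b) (-(Real.pi * y / 4) *
      (Real.cos (Real.pi * (y / 2)) / Real.sin (Real.pi * (y / 2)))) := by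
  have hy2 : y ^ 2 < 1 := by nlinarith
  have hyp : 0 < y ^ 2 := by positivity
  have a2 : |(y / 2) ^ 2| < 1 := by rw [abs_lt]; constructor <;> nlinarith
  have h2 := ze_hasSum a2
  rw [cot_real (half_pos hy) (by linarith)] at h2
  refine hs_conv h2 (fun a => ?_) ?_
  · rw [bc, show (y / 2) ^ 2 = (1 / 4) * y ^ 2 by ring, mul_pow, one_div_pow]
    ring
  · ring

lemma sc_hasSum {x : ℝ} (h0 : 0 < x) (h1 : x < 1) :
    HasSum (fun c => sc c * (x ^ 2) ^ c) (JJ 3 4 (-x ^ 2 / 4)) := by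
  have a3 : |-x ^ 2 / 4| < 1 := by rw [abs_lt]; constructor <;> nlinarith
  refine hs_conv (JJ_hasSum (p := 3) (by norm_num) 4 a3) (fun c => ?_) rfl
  rw [sc, show -x ^ 2 / 4 = (-1) * (1 / 4) * x ^ 2 by ring, mul_pow, mul_pow, one_div_pow]
  ring

/-- the finite index set -/
def idx3 (m : ℕ) : Finset (ℕ × ℕ × ℕ) :=
  (Finset.range (m + 1) ×ˢ Finset.range (m + 1) ×ˢ Finset.range (m + 1)).filter
    (fun p => p.1 + p.2.1 + 2 * p.2.2 = m)

/-- product coefficients -/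
noncomputable def tc (m : ℕ) : ℝ := ∑ p ∈ idx3 m, ac p.1 * bc p.2.1 * sc p.2.2

lemma tc_hasSum {x A B C : ℝ} (hA : HasSum (fun a => ac a * x ^ a) A)
    (hB : HasSum (fun a => bc a * x ^ a) B) (hC : HasSum (fun a => sc a * (x ^ 2) ^ a) C) :
    HasSum (fun m => tc m * x ^ m) (A * (B * C)) := by
  have sBC := summable_mul_of_summable_norm hB.summable.norm hC.summable.norm
  have hBC := hB.mul hC sBC
  have sABC := summable_mul_of_summable_norm hA.summable.norm hBC.summable.norm
  have h := hA.mul hBC sABC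
  let f : ℕ × ℕ × ℕ → ℕ := fun p => p.1 + p.2.1 + 2 * p.2.2
  have h2 := (Equiv.sigmaFiberEquiv f).hasSum_iff.mpr h
  refine h2.sigma (fun m => ?_)
  let F : ℕ × ℕ × ℕ → ℝ := fun p => ac p.1 * x ^ p.1 * (bc p.2.1 * x ^ p.2.1 * (sc p.2.2 * (x ^ 2) ^ p.2.2))
  change HasSum (F ∘ (Subtype.val : {p | f p = m} → _)) _
  rw [hasSum_subtype_iff_indicator]
  have e : tc m * x ^ m = ∑ p ∈ idx3 m, Set.indicator {p | f p = m} F p := by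
    rw [tc, Finset.sum_mul]
    apply Finset.sum_congr rfl
    intro p hp
    have hp2 : p.1 + p.2.1 + 2 * p.2.2 = m := by
      simp only [idx3, Finset.mem_filter] at hp
      exact hp.2
    rw [Set.indicator_of_mem (by exact hp2)]
    simp only [F]
    rw [← hp2, pow_add, pow_add, pow_mul]
    ring
  rw [e]
  apply hasSum_sum_of_ne_finset_zero
  intro p hp
  apply Set.indicator_of_notMem
  intro hp2
  apply hp
  have hp3 : p.1 + p.2.1 + 2 * p.2.2 = m := hp2
  simp only [idx3, Finset.mem_filter, Finset.mem_product, Finset.mem_range]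
  omega

/-- difference sequence -/
noncomputable def dc (m : ℕ) : ℝ :=
  tc m - Real.pi ^ 2 / 16 * (match m with | 0 => 0 | m + 1 => gg m - ec m)

lemma dc_zero (m : ℕ) : dc m = 0 := by
  apply ps_unique (ε := 1 / 8) (by norm_num)
  intro x hx hx8
  set y := Real.sqrt x with hy
  have hyx : y ^ 2 = x := Real.sq_sqrt hx.le
  have hy0 : 0 < y := Real.sqrt_pos.mpr hx
  have hy1 : y < 1 := by nlinarith
  have hG := gg_hasSum hy0 (by linarith)
  rw [jj_formula hy0 hy1 (EE_lim hy0 hy1)] at hG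
  have hA := ac_hasSum hy0 hy1
  have hB := bc_hasSum hy0 hy1
  rw [hyx] at hG hA hB
  have hE := ec_hasSum hx (by linarith)
  have hC := sc_hasSum hx (by linarith)
  have hT := tc_hasSum hA hB hC
  have hD := (hG.sub hE).mul_left x
  have hD2 : ∀ V, HasSum (fun i => x * (gg i * x ^ i - ec i * x ^ i)) V →
      HasSum (fun m : ℕ => (match m with | 0 => 0 | m + 1 => gg m - ec m : ℝ) * x ^ m) V := by
    intro V hV
    rw [← hasSum_nat_add_iff' 1]
    refine hs_conv hV (fun m => ?_) ?_
    · simp only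
      ring
    · simp
  refine hs_conv (hT.sub ((hD2 _ hD).mul_left (Real.pi ^ 2 / 16))) (fun m => ?_) ?_
  · rw [dc.eq_def]
    ring
  · rw [← hyx]
    ring

lemma gg_eval (n : ℕ) : -gg (2 * n + 1) = (4 + 1 / 2 * (-1 / 4) ^ n) * zr (4 * n + 5)
    - 16 / Real.pi ^ 2 * tc (2 * n + 2) := by
  have h := dc_zero (2 * n + 2)
  unfold dc at h
  simp only at h
  rw [ec_odd] at h
  have hp := Real.pi_ne_zero
  have : gg (2 * n + 1) = 16 / Real.pi ^ 2 * tc (2 * n + 2)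
      + -(4 + 1 / 2 * (-1 / 4) ^ n) * zr (4 * n + 5) := by
    field_simp
    linear_combination (-32) * h
  rw [this]
  ring


/-- The evaluation of `ζ⋆(2, {1,3}^n, 1, 2)` in terms of Riemann zeta
values (with the convention `ζ(0) = −1/2`, which `riemannZeta` satisfies). -/
theorem zetaStar_2_1313_1_2 (n : ℕ) :
    ((zetaStar (Fin.cons 2 (Fin.snoc (Fin.snoc (pat13 n) 1) 2)) : ℝ) : ℂ) =
      (4 + 1 / (2 * (-4 : ℂ) ^ n)) * riemannZeta (4 * n + 5)
      - 8 / (3 * riemannZeta 2) *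
          ∑ p ∈ (Finset.range (2 * n + 3) ×ˢ Finset.range (2 * n + 3) ×ˢ
              Finset.range (2 * n + 3)).filter
              (fun p => p.1 + p.2.1 + 2 * p.2.2 = 2 * n + 2),
            (-1 : ℂ) ^ (p.1 + p.2.2) * (1 - 2 ^ (2 * p.1)) /
              4 ^ (p.1 + p.2.1 + p.2.2) *
              riemannZeta (2 * p.1) * riemannZeta (2 * p.2.1) *
              riemannZeta (4 * p.2.2 + 3) := by
  rw [zetaStar_eq_gg, gg_eval]
  have h1 : riemannZeta (4 * n + 5) = ((zr (4 * n + 5) : ℝ) : ℂ) := by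
    rw [← zr_cast (by omega)]
    push_cast
    rfl
  have h2 : ((tc (2 * n + 2) : ℝ) : ℂ) = ∑ p ∈ (Finset.range (2 * n + 3) ×ˢ Finset.range (2 * n + 3) ×ˢ
              Finset.range (2 * n + 3)).filter
              (fun p => p.1 + p.2.1 + 2 * p.2.2 = 2 * n + 2),
            (-1 : ℂ) ^ (p.1 + p.2.2) * (1 - 2 ^ (2 * p.1)) /
              4 ^ (p.1 + p.2.1 + p.2.2) *
              riemannZeta (2 * p.1) * riemannZeta (2 * p.2.1) *
              riemannZeta (4 * p.2.2 + 3) := by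
    rw [tc, Complex.ofReal_sum]
    apply Finset.sum_congr rfl
    intro p _
    have e : riemannZeta (4 * (p.2.2 : ℂ) + 3) = ((zr (3 + 4 * p.2.2) : ℝ) : ℂ) := by
      rw [← zr_cast (by omega)]
      push_cast
      rw [add_comm]
    rw [e, ze_cast, ze_cast, ac, bc, sc, pow_mul, pow_add, pow_add, pow_add]
    push_cast
    norm_num
    field_simp
  rw [← h2, h1, riemannZeta_two]
  have hp : (Real.pi : ℂ) ≠ 0 := by exact_mod_cast Real.pi_ne_zero
  have h3 : (-1 / 4 : ℂ) ^ n = 1 / (-4) ^ n := by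
    rw [show (-1 / 4 : ℂ) = 1 / (-4) by norm_num, one_div_pow]
  push_cast
  rw [h3]
  have h4 : (-4 : ℂ) ^ n ≠ 0 := pow_ne_zero _ (by norm_num)
  field_simp
  ring
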